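/- arXiv:1301.5895 — 7 statements merged into one kernel-verified Lean document; each statement's English description precedes it below -/
import Mathlib

section
/- Define c_l = P_l(1) + 3·P_l(4/5) + P_l(3/5) + 4·P_l(2/5) + 2·P_l(1/5) + P_l(0), where P_l is the Legendre polynomial of degree l. Then for every natural number l, c_l = 0 if and only if l = 2. -/
noncomputable section

/-- The Legendre polynomials, via `P₀(t) = 1`, `P₁(t) = t`, and the recurrence
`(l+1)·P_{l+1}(t) = (2l+1)·t·P_l(t) − l·P_{l−1}(t)`. -/
def legendreP : ℕ → ℝ → ℝ
  | 0, _ => 1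
  | 1, t => t
  | l + 2, t =>
      ((2 * (l : ℝ) + 3) * t * legendreP (l + 1) t - ((l : ℝ) + 1) * legendreP l t)
        / ((l : ℝ) + 2)

/-- `c_l = P_l(1) + 3·P_l(4/5) + P_l(3/5) + 4·P_l(2/5) + 2·P_l(1/5) + P_l(0)`. -/
def legendreC (l : ℕ) : ℝ :=
  legendreP l 1 + 3 * legendreP l (4 / 5) + legendreP l (3 / 5)
    + 4 * legendreP l (2 / 5) + 2 * legendreP l (1 / 5) + legendreP l 0

/-- The real numbers that are fractions of integers with odd denominator. -/
def oddDenominators : Subring ℝ where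
  carrier := {x | ∃ a b : ℤ, Odd b ∧ x * b = a}
  mul_mem' := by
    rintro x y ⟨a, b, hb, h⟩ ⟨c, d, hd, k⟩
    refine ⟨a * c, b * d, hb.mul hd, ?_⟩
    push_cast
    rw [← h, ← k]
    ring
  one_mem' := ⟨1, 1, odd_one, by simp⟩
  add_mem' := by
    rintro x y ⟨a, b, hb, h⟩ ⟨c, d, hd, k⟩
    refine ⟨a * d + c * b, b * d, hb.mul hd, ?_⟩
    push_cast
    rw [← h, ← k]
    ring
  zero_mem' := ⟨0, 1, odd_one, by simp⟩
  neg_mem' := by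
    rintro x ⟨a, b, hb, h⟩
    refine ⟨-a, b, hb, ?_⟩
    push_cast
    rw [← h]
    ring

lemma div_mem_oddDenominators {x : ℝ} (hx : x ∈ oddDenominators) {n : ℕ} (hn : Odd n) :
    x / n ∈ oddDenominators := by
  have hn0 : (n : ℝ) ≠ 0 := by exact_mod_cast hn.pos.ne'
  rw [div_eq_mul_inv]
  refine mul_mem hx ⟨1, n, by exact_mod_cast hn, ?_⟩
  push_cast
  exact inv_mul_cancel₀ hn0

lemma half_notMem_oddDenominators : (1 / 2 : ℝ) ∉ oddDenominators := by
  rintro ⟨a, b, hb, h⟩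
  have h' : b = 2 * a := by
    have : (b : ℝ) = 2 * a := by linarith
    exact_mod_cast this
  rw [h'] at hb
  exact (Int.not_odd_iff_even.mpr (even_two_mul a)) hb

lemma legendreP_recurrence (l : ℕ) (t : ℝ) :
    ((l : ℝ) + 2) * legendreP (l + 2) t =
      (2 * (l : ℝ) + 3) * t * legendreP (l + 1) t - ((l : ℝ) + 1) * legendreP l t := by
  have h : (l : ℝ) + 2 ≠ 0 := by positivity
  rw [legendreP]
  field_simp

/-- The coefficient of `xⁿ` in `P_l(1 + 2x)`. -/
def legendreCoeff (l n : ℕ) : ℕ := l.choose n * (l + n).choose n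

lemma legendreCoeff_eq_zero {l n : ℕ} (h : l < n) : legendreCoeff l n = 0 := by
  simp [legendreCoeff, Nat.choose_eq_zero_of_lt h]

lemma legendreCoeff_succ (l n : ℕ) :
    ((n : ℝ) + 1) ^ 2 * legendreCoeff l (n + 1) =
      ((l : ℝ) - n) * ((l : ℝ) + n + 1) * legendreCoeff l n := by
  have h₁ : (l.choose (n + 1) : ℝ) * (n + 1) = l.choose n * ((l : ℝ) - n) := by
    rcases le_or_gt n l with h | h
    · have := Nat.choose_succ_right_eq l n
      rw [← Nat.cast_sub h]
      exact_mod_cast this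
    · simp [Nat.choose_eq_zero_of_lt h, Nat.choose_eq_zero_of_lt (h.trans n.lt_succ_self)]
  have h₂ : ((l : ℝ) + n + 1) * (l + n).choose n = (l + n + 1).choose (n + 1) * (n + 1) := by
    exact_mod_cast Nat.add_one_mul_choose_eq (l + n) n
  simp only [legendreCoeff, ← add_assoc]
  push_cast
  linear_combination ((l + n + 1).choose (n + 1) * (n + 1) : ℝ) * h₁ -
    (l.choose n * ((l : ℝ) - n)) * h₂

lemma exists_legendreCoeff_eq (l n : ℕ) : ∃ h : ℝ,
    legendreCoeff l n = ((l : ℝ) + 1 - n) * (l + 2 - n) * h ∧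
    legendreCoeff (l + 1) n = ((l : ℝ) + 1 + n) * (l + 2 - n) * h ∧
    legendreCoeff (l + 2) n = ((l : ℝ) + 1 + n) * (l + 2 + n) * h := by
  induction n with
  | zero =>
    refine ⟨1 / (((l : ℝ) + 1) * (l + 2)), ?_⟩
    have h₁ : (l : ℝ) + 1 ≠ 0 := by positivity
    have h₂ : (l : ℝ) + 2 ≠ 0 := by positivity
    simp [legendreCoeff]
    field_simp
  | succ n ih =>
    obtain ⟨h, h₀, h₁, h₂⟩ := ih
    have hn : ((n : ℝ) + 1) ^ 2 ≠ 0 := by positivity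
    have s₀ := legendreCoeff_succ l n
    have s₁ := legendreCoeff_succ (l + 1) n
    have s₂ := legendreCoeff_succ (l + 2) n
    rw [h₀] at s₀
    rw [h₁] at s₁
    rw [h₂] at s₂
    refine ⟨h * (l + 2 - n) * (l + 1 + n) / (n + 1) ^ 2, ?_, ?_, ?_⟩ <;>
      refine mul_left_cancel₀ hn ?_
    · rw [s₀]; push_cast; field_simp; ring
    · rw [s₁]; push_cast; field_simp; ring
    · rw [s₂]; push_cast; field_simp; ring

lemma legendreCoeff_recurrence (l n : ℕ) :
    ((l : ℝ) + 2) * legendreCoeff (l + 2) (n + 1) + (l + 1) * legendreCoeff l (n + 1) =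
      (2 * l + 3) * (legendreCoeff (l + 1) (n + 1) + 2 * legendreCoeff (l + 1) n) := by
  obtain ⟨h, h₀, h₁, h₂⟩ := exists_legendreCoeff_eq l n
  have s₀ := legendreCoeff_succ l n
  have s₁ := legendreCoeff_succ (l + 1) n
  have s₂ := legendreCoeff_succ (l + 2) n
  have hn : ((n : ℝ) + 1) ^ 2 ≠ 0 := by positivity
  rw [h₀] at s₀
  rw [h₁] at s₁
  rw [h₂] at s₂
  rw [h₁]
  push_cast at s₀ s₁ s₂
  refine mul_left_cancel₀ hn ?_
  linear_combination ((l : ℝ) + 2) * s₂ + ((l : ℝ) + 1) * s₀ - (2 * (l : ℝ) + 3) * s₁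

lemma legendreP_one_add_two_mul (x : ℝ) (l N : ℕ) (hN : l < N) :
    legendreP l (1 + 2 * x) = ∑ n ∈ Finset.range N, legendreCoeff l n * x ^ n := by
  induction l using Nat.twoStepInduction generalizing N with
  | zero =>
    obtain ⟨N, rfl⟩ := Nat.exists_eq_add_of_lt hN
    rw [Finset.sum_range_succ', Finset.sum_eq_zero]
    · simp [legendreP, legendreCoeff]
    · intro n _
      simp [legendreCoeff_eq_zero]
  | one =>
    obtain ⟨N, rfl⟩ := Nat.exists_eq_add_of_lt hN
    rw [add_comm 1 N, Finset.sum_range_succ', Finset.sum_range_succ', Finset.sum_eq_zero]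
    · simp [legendreP, legendreCoeff]
      ring
    · intro n _
      simp [legendreCoeff_eq_zero]
  | more l ih₀ ih₁ =>
    obtain ⟨N, rfl⟩ : ∃ M, N = M + 1 := ⟨N - 1, by lia⟩
    have hl : (l : ℝ) + 2 ≠ 0 := by positivity
    refine mul_left_cancel₀ hl ?_
    have hx : legendreP (l + 1) (1 + 2 * x) * x =
        ∑ n ∈ Finset.range N, legendreCoeff (l + 1) n * x ^ (n + 1) := by
      rw [ih₁ N (by lia), Finset.sum_mul]
      exact Finset.sum_congr rfl fun n _ => by ring
    have e₀ := ih₀ (N + 1) (by lia)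
    have e₁ := ih₁ (N + 1) (by lia)
    rw [Finset.sum_range_succ'] at e₀ e₁ ⊢
    have key : ∑ n ∈ Finset.range N, (((l : ℝ) + 2) * (legendreCoeff (l + 2) (n + 1) * x ^ (n + 1))
          + (l + 1) * (legendreCoeff l (n + 1) * x ^ (n + 1))) =
        ∑ n ∈ Finset.range N, ((2 * (l : ℝ) + 3) * (legendreCoeff (l + 1) (n + 1) * x ^ (n + 1)
          + 2 * (legendreCoeff (l + 1) n * x ^ (n + 1)))) :=
      Finset.sum_congr rfl fun n _ => by
        linear_combination x ^ (n + 1) * legendreCoeff_recurrence l n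
    simp only [Finset.sum_add_distrib, ← Finset.mul_sum] at key
    simp only [legendreCoeff, Nat.choose_zero_right, pow_zero, mul_one, Nat.cast_one] at e₀ e₁ ⊢
    simp only [legendreCoeff] at key hx
    rw [legendreP_recurrence]
    linear_combination (2 * (l : ℝ) + 3) * e₁ - ((l : ℝ) + 1) * e₀ +
      2 * (2 * (l : ℝ) + 3) * hx - key

lemma legendreP_one_add_two_mul_mem {x : ℝ} (hx : x ∈ oddDenominators) (l : ℕ) :
    legendreP l (1 + 2 * x) ∈ oddDenominators := by
  rw [legendreP_one_add_two_mul x l (l + 1) l.lt_succ_self]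
  exact sum_mem fun n _ => mul_mem (natCast_mem _ _) (pow_mem hx n)

lemma legendreP_even_zero_recurrence (m : ℕ) :
    (2 * (m : ℝ) + 2) * legendreP (2 * (m + 1)) 0 = -(2 * m + 1) * legendreP (2 * m) 0 := by
  have := legendreP_recurrence (2 * m) 0
  push_cast at this
  rw [mul_add_one, this]
  ring

lemma legendreP_even_zero_ne_zero (m : ℕ) : legendreP (2 * m) 0 ≠ 0 := by
  induction m with
  | zero => simp [legendreP]
  | succ m ih =>
    intro h
    have := legendreP_even_zero_recurrence m
    rw [h, mul_zero, eq_comm, mul_eq_zero] at this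
    rcases this with h | h
    · have : (0 : ℝ) ≤ m := m.cast_nonneg
      linarith
    · exact ih h

/-- The `2`-adic valuation of `P_{2m}(0)` is nonincreasing in `m`. -/
lemma exists_inv_legendreP_even_zero_eq {c : ℝ} {m₀ m : ℕ} (hm : m₀ ≤ m)
    (h₀ : ∃ u ∈ oddDenominators, (legendreP (2 * m₀) 0)⁻¹ = c * u) :
    ∃ u ∈ oddDenominators, (legendreP (2 * m) 0)⁻¹ = c * u := by
  induction m, hm using Nat.le_induction with
  | base => exact h₀
  | succ m hm ih =>
    obtain ⟨u, hu, h⟩ := ih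
    refine ⟨-((2 * m + 2 : ℕ) * u / (2 * m + 1 : ℕ)),
      neg_mem (div_mem_oddDenominators (mul_mem (natCast_mem _ _) hu) (odd_two_mul_add_one m)), ?_⟩
    have hr := legendreP_even_zero_recurrence m
    have p₀ := legendreP_even_zero_ne_zero m
    have p₁ := legendreP_even_zero_ne_zero (m + 1)
    have hm1 : (2 * (m : ℝ) + 1) ≠ 0 := by positivity
    have : (legendreP (2 * (m + 1)) 0)⁻¹ =
        -((2 * m + 2) / (2 * m + 1)) * (legendreP (2 * m) 0)⁻¹ := by
      field_simp
      linear_combination hr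
    rw [this, h]
    push_cast
    ring

lemma exists_legendreP_eq {t : ℝ} (ht : t ∈ oddDenominators) (m : ℕ) :
    ∃ e ∈ oddDenominators, ∃ o ∈ oddDenominators,
      legendreP (2 * m) t = legendreP (2 * m) 0 * (1 + t ^ 2 * e) ∧
      legendreP (2 * m + 1) t = (2 * m + 1) * legendreP (2 * m) 0 * (t * (1 + t ^ 2 * o)) := by
  induction m with
  | zero => exact ⟨0, zero_mem _, 0, zero_mem _, by simp [legendreP], by simp [legendreP]⟩
  | succ m ih =>
    obtain ⟨e, he, o, ho, hE, hO⟩ := ih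
    have hr := legendreP_even_zero_recurrence m
    have r₁ := legendreP_recurrence (2 * m) t
    have r₂ := legendreP_recurrence (2 * m + 1) t
    set p := legendreP (2 * m) 0
    set p' := legendreP (2 * (m + 1)) 0
    have hm2 : (2 * (m : ℝ) + 2) ≠ 0 := by positivity
    have hm3 : (2 * (m : ℝ) + 3) ≠ 0 := by positivity
    obtain ⟨e', he', hee⟩ : ∃ e' ∈ oddDenominators, e' = e - (4 * m + 3 : ℕ) * (1 + t ^ 2 * o) :=
      ⟨_, sub_mem he (mul_mem (natCast_mem _ _)
        (add_mem (one_mem _) (mul_mem (pow_mem ht 2) ho))), rfl⟩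
    obtain ⟨o', ho', hoo⟩ : ∃ o' ∈ oddDenominators,
        o' = ((4 * m + 5 : ℕ) * e' + (4 * (m + 1) ^ 2 : ℕ) * o) / ((2 * m + 3) ^ 2 : ℕ) :=
      ⟨_, div_mem_oddDenominators (add_mem (mul_mem (natCast_mem _ _) he')
        (mul_mem (natCast_mem _ _) ho)) (Odd.pow ⟨m + 1, by ring⟩), rfl⟩
    have hE' : legendreP (2 * (m + 1)) t = p' * (1 + t ^ 2 * e') := by
      refine mul_left_cancel₀ hm2 ?_
      rw [← mul_assoc, hr, mul_add_one, hee]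
      rw [hE, hO] at r₁
      push_cast at r₁ ⊢
      rw [r₁]
      ring
    refine ⟨e', he', o', ho', hE', ?_⟩
    refine mul_left_cancel₀ hm3 ?_
    have ho2 : (2 * (m : ℝ) + 3) ^ 2 * o' = (4 * m + 5) * e' + 4 * (m + 1) ^ 2 * o := by
      rw [hoo]
      push_cast
      field_simp
    rw [show 2 * m + 1 + 1 = 2 * (m + 1) by ring, hE', hO] at r₂
    rw [show 2 * m + 1 + 2 = 2 * (m + 1) + 1 by ring] at r₂
    push_cast at r₂ ⊢
    linear_combination r₂ - p' * t ^ 3 * ho2 - t * (1 + t ^ 2 * o) * (2 * m + 2) * hr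

lemma div_five_mem_oddDenominators (a : ℤ) : (a : ℝ) / 5 ∈ oddDenominators :=
  mod_cast div_mem_oddDenominators (intCast_mem _ a) (n := 5) (by decide)

/-- The part of `c_l` coming from arguments with odd numerator is `2`-integral. -/
lemma legendreP_odd_numerators_mem (l : ℕ) :
    legendreP l 1 + legendreP l (3 / 5) + 2 * legendreP l (1 / 5) ∈ oddDenominators := by
  have h₀ := legendreP_one_add_two_mul_mem (zero_mem _) l
  have h₁ := legendreP_one_add_two_mul_mem (div_five_mem_oddDenominators (-1)) l
  have h₂ := legendreP_one_add_two_mul_mem (div_five_mem_oddDenominators (-2)) l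
  norm_num at h₀ h₁ h₂
  exact add_mem (add_mem h₀ h₁) (mul_mem (ofNat_mem _ 2) h₂)

lemma legendreC_even_ne_zero {m : ℕ} (hm : 3 ≤ m) : legendreC (2 * m) ≠ 0 := by
  intro hc
  obtain ⟨u, hu, hinv⟩ := exists_inv_legendreP_even_zero_eq (c := 16) hm
    ⟨((-1 : ℤ) : ℝ) / 5, div_five_mem_oddDenominators _, by norm_num [legendreP]⟩
  obtain ⟨e, he, -, -, h₄, -⟩ := exists_legendreP_eq (div_five_mem_oddDenominators 4) m
  obtain ⟨f, hf, -, -, h₂, -⟩ := exists_legendreP_eq (div_five_mem_oddDenominators 2) m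
  have hr := legendreP_odd_numerators_mem (2 * m)
  have hp := mul_inv_cancel₀ (legendreP_even_zero_ne_zero m)
  push_cast at h₄ h₂
  rw [legendreC, h₄, h₂] at hc
  rw [hinv] at hp
  set p := legendreP (2 * m) 0
  set r := legendreP (2 * m) 1 + legendreP (2 * m) (3 / 5) + 2 * legendreP (2 * m) (1 / 5) with hrd
  have h25 : ∀ {x : ℝ}, x ∈ oddDenominators → x / 25 ∈ oddDenominators := fun hx =>
    mod_cast div_mem_oddDenominators hx (n := 25) (by decide)
  refine half_notMem_oddDenominators ?_
  have : (1 / 2 : ℝ) = -(r * u + 3 * (e / 25) + f / 25) := by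
    linear_combination u * hc - (1 / 2 + 3 * (e / 25) + f / 25) * hp - u * hrd
  rw [this]
  exact neg_mem (add_mem (add_mem (mul_mem hr hu) (mul_mem (ofNat_mem _ 3) (h25 he))) (h25 hf))

lemma legendreC_odd_ne_zero {m : ℕ} (hm : 2 ≤ m) : legendreC (2 * m + 1) ≠ 0 := by
  intro hc
  obtain ⟨u, hu, hinv⟩ := exists_inv_legendreP_even_zero_eq (c := 8) hm
    ⟨((1 : ℕ) : ℝ) / (3 : ℕ), div_mem_oddDenominators (natCast_mem _ _) (by decide),
      by norm_num [legendreP]⟩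
  obtain ⟨-, -, e, he, -, h₄⟩ := exists_legendreP_eq (div_five_mem_oddDenominators 4) m
  obtain ⟨-, -, f, hf, -, h₂⟩ := exists_legendreP_eq (div_five_mem_oddDenominators 2) m
  obtain ⟨_, _, _, _, -, h₀⟩ := exists_legendreP_eq (zero_mem oddDenominators) m
  have hr := legendreP_odd_numerators_mem (2 * m + 1)
  have hp := mul_inv_cancel₀ (legendreP_even_zero_ne_zero m)
  push_cast at h₄ h₂
  rw [legendreC, h₄, h₂, h₀] at hc
  rw [hinv] at hp
  set p := legendreP (2 * m) 0
  set r := legendreP (2 * m + 1) 1 + legendreP (2 * m + 1) (3 / 5) +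
    2 * legendreP (2 * m + 1) (1 / 5) with hrd
  have h125 : ∀ {x : ℝ}, x ∈ oddDenominators → x / 125 ∈ oddDenominators := fun hx =>
    mod_cast div_mem_oddDenominators hx (n := 125) (by decide)
  obtain ⟨v, hv, hvu⟩ : ∃ v ∈ oddDenominators, v = u / (2 * m + 1 : ℕ) :=
    ⟨_, div_mem_oddDenominators hu (odd_two_mul_add_one m), rfl⟩
  have hm1 : (2 * (m : ℝ) + 1) ≠ 0 := by positivity
  have hv' : (2 * (m : ℝ) + 1) * v = u := by
    rw [hvu]
    push_cast
    field_simp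
  rw [← hv'] at hp
  refine half_notMem_oddDenominators ?_
  have : (1 / 2 : ℝ) = -(r * v + 24 * (e / 125) + 4 * (f / 125)) := by
    linear_combination v * hc - (1 / 2 + 24 * (e / 125) + 4 * (f / 125)) * hp - v * hrd
  rw [this]
  exact neg_mem (add_mem (add_mem (mul_mem hr hv) (mul_mem (ofNat_mem _ 24) (h125 he)))
    (mul_mem (ofNat_mem _ 4) (h125 hf)))

/-- `c_l = 0` if and only if `l = 2`. -/
theorem legendreC_eq_zero_iff (l : ℕ) : legendreC l = 0 ↔ l = 2 := by
  constructor
  · intro h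
    obtain ⟨m, rfl | rfl⟩ := l.even_or_odd'
    · have hm : m < 3 := not_le.mp fun hm => legendreC_even_ne_zero hm h
      interval_cases m
      · norm_num [legendreC, legendreP] at h
      · rfl
      · norm_num [legendreC, legendreP] at h
    · have hm : m < 2 := not_le.mp fun hm => legendreC_odd_ne_zero hm h
      interval_cases m <;> norm_num [legendreC, legendreP] at h
  · rintro rfl
    norm_num [legendreC, legendreP]
end
end

section
/- Define c_l = P_l(1) + 3·P_l(4/5) + P_l(3/5) + 4·P_l(2/5) + 2·P_l(1/5) + P_l(0), where P_l is the Legendre polynomial of degree l. Then there exists a constant C > 0 such that |c_l − 1| ≤ C·l^{−1/2} for all l ≥ 1. -/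
noncomputable section

theorem legendreP_one (l : ℕ) : legendreP l 1 = 1 := by
  induction l using Nat.twoStepInduction with
  | zero => simp [legendreP]
  | one => simp [legendreP]
  | more n h₀ h₁ =>
    rw [legendreP, h₀, h₁]
    field_simp
    ring

/-- A quadratic form in two consecutive Legendre values, almost conserved by the recurrence. -/
def legendreEnergy (t : ℝ) (n : ℕ) : ℝ :=
  (2 * n + 1) * legendreP n t ^ 2 + (2 * n + 3) * legendreP (n + 1) t ^ 2
    - 2 * t * (2 * n + 2) * (legendreP n t * legendreP (n + 1) t)

theorem legendreEnergy_succ (t : ℝ) (n : ℕ) :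
    legendreEnergy t (n + 1) = legendreEnergy t n
      + 2 * (legendreP n t - t * legendreP (n + 1) t) * (t * legendreP (n + 1) t) / (n + 2)
      + (legendreP n t - t * legendreP (n + 1) t) ^ 2 / (n + 2) ^ 2 := by
  have h : (n : ℝ) + 2 ≠ 0 := by positivity
  simp only [legendreEnergy, legendreP]
  push_cast
  field_simp
  ring

theorem le_legendreEnergy {t : ℝ} (ht₀ : 0 ≤ t) (ht : t ≤ 4 / 5) {n : ℕ} (hn : 3 ≤ n) :
    n / 5 * (legendreP n t ^ 2 + legendreP (n + 1) t ^ 2) ≤ legendreEnergy t n := by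
  have hn' : (3 : ℝ) ≤ n := by exact_mod_cast hn
  unfold legendreEnergy
  generalize legendreP n t = a
  generalize legendreP (n + 1) t = b
  have h₁ : 2 * t * (a * b) ≤ 4 / 5 * (a ^ 2 + b ^ 2) := by
    nlinarith [mul_nonneg ht₀ (sq_nonneg (a - b)),
      mul_nonneg (sub_nonneg.2 ht) (add_nonneg (sq_nonneg a) (sq_nonneg b))]
  have h₂ := mul_le_mul_of_nonneg_left h₁ (by positivity : (0 : ℝ) ≤ 2 * n + 2)
  nlinarith [mul_nonneg (sub_nonneg.2 hn') (sq_nonneg a),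
    mul_nonneg (sub_nonneg.2 hn') (sq_nonneg b), sq_nonneg a, sq_nonneg b]

theorem legendreEnergy_succ_le {t : ℝ} (ht₀ : 0 ≤ t) (ht : t ≤ 4 / 5) {n : ℕ} (hn : 3 ≤ n) :
    legendreEnergy t (n + 1) ≤ legendreEnergy t n * (1 + 25 / (n * (n + 1))) := by
  have hn' : (3 : ℝ) ≤ n := by exact_mod_cast hn
  have hE := le_legendreEnergy ht₀ ht hn
  rw [legendreEnergy_succ]
  set a := legendreP n t
  set b := legendreP (n + 1) t
  have hb : (t * b) ^ 2 ≤ b ^ 2 := by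
    rw [mul_pow]
    exact mul_le_of_le_one_left (sq_nonneg b) (pow_le_one₀ ht₀ (by linarith))
  have h₁ : 2 * (a - t * b) * (t * b) / (n + 2) ≤ (a ^ 2 + b ^ 2) / (n + 1) := by
    apply div_le_div₀ (by positivity) _ (by positivity) (by linarith)
    nlinarith [sq_nonneg (a - t * b)]
  have h₂ : (a - t * b) ^ 2 / (n + 2) ^ 2 ≤ 2 * (a ^ 2 + b ^ 2) / (n + 1) := by
    apply div_le_div₀ (by positivity) _ (by positivity) (by nlinarith)
    nlinarith [sq_nonneg (a + t * b)]
  have h₃ : 5 * (a ^ 2 + b ^ 2) / (n + 1) ≤ legendreEnergy t n * (25 / (n * (n + 1))) := by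
    calc 5 * (a ^ 2 + b ^ 2) / (n + 1)
        = n / 5 * (a ^ 2 + b ^ 2) * (25 / (n * (n + 1))) := by field_simp; ring
      _ ≤ _ := by gcongr
  have h₄ : 0 ≤ (a ^ 2 + b ^ 2) / (n + 1) := by positivity
  rw [mul_div_assoc] at h₂ h₃
  linarith

theorem legendreEnergy_mul_exp_le {t : ℝ} (ht₀ : 0 ≤ t) (ht : t ≤ 4 / 5) {n : ℕ} (hn : 3 ≤ n) :
    legendreEnergy t n * Real.exp (25 / n) ≤ legendreEnergy t 3 * Real.exp (25 / 3) := by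
  induction n, hn using Nat.le_induction with
  | base => simp
  | succ n hn ih =>
    refine le_trans ?_ ih
    have hn' : (3 : ℝ) ≤ n := by exact_mod_cast hn
    have hE : 0 ≤ legendreEnergy t n := le_trans (by positivity) (le_legendreEnergy ht₀ ht hn)
    calc legendreEnergy t (n + 1) * Real.exp (25 / (n + 1 : ℕ))
        ≤ legendreEnergy t n * (1 + 25 / (n * (n + 1))) * Real.exp (25 / (n + 1 : ℕ)) := by
          gcongr
          exact legendreEnergy_succ_le ht₀ ht hn
      _ ≤ legendreEnergy t n * Real.exp (25 / (n * (n + 1))) * Real.exp (25 / (n + 1 : ℕ)) := by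
          gcongr
          rw [add_comm]
          exact Real.add_one_le_exp _
      _ = legendreEnergy t n * Real.exp (25 / n) := by
          rw [mul_assoc, ← Real.exp_add]
          congr 2
          push_cast
          field_simp
          ring

theorem exists_abs_legendreP_le {t : ℝ} (ht₀ : 0 ≤ t) (ht : t ≤ 4 / 5) :
    ∃ C : ℝ, 0 ≤ C ∧ ∀ l : ℕ, 1 ≤ l → |legendreP l t| ≤ C * (l : ℝ) ^ (-(1 / 2 : ℝ)) := by
  set M := legendreEnergy t 3 * Real.exp (25 / 3)
  have hM : 0 ≤ M := mul_nonneg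
    (le_trans (by positivity) (le_legendreEnergy ht₀ ht le_rfl)) (Real.exp_pos _).le
  set K := 5 * M + legendreP 1 t ^ 2 + 2 * legendreP 2 t ^ 2
  have hK : ∀ l : ℕ, 1 ≤ l → l * legendreP l t ^ 2 ≤ K := by
    intro l hl
    rcases lt_or_ge l 3 with h | h
    · interval_cases l
      · norm_num [K]
        nlinarith [sq_nonneg (legendreP 2 t)]
      · norm_num [K]
        nlinarith [sq_nonneg (legendreP 1 t)]
    · have h₁ := le_legendreEnergy ht₀ ht h
      have hE : 0 ≤ legendreEnergy t l := le_trans (by positivity) h₁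
      have h₂ : legendreEnergy t l ≤ M :=
        (le_mul_of_one_le_right hE (Real.one_le_exp (by positivity))).trans
          (legendreEnergy_mul_exp_le ht₀ ht h)
      have h₃ : 0 ≤ (l : ℝ) * legendreP (l + 1) t ^ 2 := by positivity
      simp only [K]
      nlinarith [sq_nonneg (legendreP 1 t), sq_nonneg (legendreP 2 t)]
  refine ⟨√K, Real.sqrt_nonneg _, fun l hl => ?_⟩
  have hl' : (0 : ℝ) < l := by exact_mod_cast hl
  rw [Real.rpow_neg hl'.le, ← Real.sqrt_eq_rpow, ← div_eq_mul_inv, ← Real.sqrt_div' _ hl'.le]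
  apply Real.abs_le_sqrt
  rw [le_div_iff₀ hl', mul_comm]
  exact hK l hl

/-- There is a constant `C > 0` with `|c_l − 1| ≤ C·l^{−1/2}` for all `l ≥ 1`. -/
theorem legendreC_sub_one_bound : ∃ C : ℝ, 0 < C ∧ ∀ l : ℕ, 1 ≤ l →
    |legendreC l - 1| ≤ C * (l : ℝ) ^ (-(1 / 2 : ℝ)) := by
  obtain ⟨A, hA₀, hA⟩ := exists_abs_legendreP_le (t := 4 / 5) (by norm_num) (by norm_num)
  obtain ⟨B, hB₀, hB⟩ := exists_abs_legendreP_le (t := 3 / 5) (by norm_num) (by norm_num)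
  obtain ⟨D, hD₀, hD⟩ := exists_abs_legendreP_le (t := 2 / 5) (by norm_num) (by norm_num)
  obtain ⟨E, hE₀, hE⟩ := exists_abs_legendreP_le (t := 1 / 5) (by norm_num) (by norm_num)
  obtain ⟨F, hF₀, hF⟩ := exists_abs_legendreP_le (t := 0) (by norm_num) (by norm_num)
  refine ⟨3 * A + B + 4 * D + 2 * E + F + 1, by positivity, fun l hl => ?_⟩
  have hr : 0 ≤ (l : ℝ) ^ (-(1 / 2 : ℝ)) := by positivity
  have hA := abs_le.1 (hA l hl)
  have hB := abs_le.1 (hB l hl)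
  have hD := abs_le.1 (hD l hl)
  have hE := abs_le.1 (hE l hl)
  have hF := abs_le.1 (hF l hl)
  rw [legendreC, legendreP_one, abs_le]
  constructor <;> linarith [hA.1, hA.2, hB.1, hB.2, hD.1, hD.2, hE.1, hE.2, hF.1, hF.2]
end
end

section
/- For every k ∈ {1,3,5} and every l ≥ 6, the integer 5^l · l! · P_l(k/5) is divisible by 16, where P_l is the Legendre polynomial of degree l. -/
noncomputable section

/-- The integers `5^l · l! · P_l(k/5)`, via their own recurrence. -/
def legendreRescaled (k : ℤ) : ℕ → ℤ
  | 0 => 1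
  | 1 => k
  | l + 2 => (2 * (l : ℤ) + 3) * k * legendreRescaled k (l + 1)
      - 25 * ((l : ℤ) + 1) ^ 2 * legendreRescaled k l

theorem legendreRescaled_cast (k : ℤ) (l : ℕ) :
    (legendreRescaled k l : ℝ) =
      (5 : ℝ) ^ l * (Nat.factorial l : ℝ) * legendreP l ((k : ℝ) / 5) := by
  induction l using Nat.twoStepInduction with
  | zero => simp [legendreRescaled, legendreP]
  | one => simp [legendreRescaled, legendreP]; ring
  | more l ih₀ ih₁ =>
    have hl : (l : ℝ) + 2 ≠ 0 := by positivity
    simp only [legendreRescaled, legendreP]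
    push_cast [Nat.factorial_succ] at ih₁ ⊢
    rw [ih₀, ih₁]
    field_simp
    ring

theorem sixteen_dvd_legendreRescaled {k : ℤ} (h₆ : 16 ∣ legendreRescaled k 6)
    (h₇ : 16 ∣ legendreRescaled k 7) (n : ℕ) : 16 ∣ legendreRescaled k (n + 6) := by
  induction n using Nat.twoStepInduction with
  | zero => exact h₆
  | one => exact h₇
  | more n ih₀ ih₁ => exact dvd_sub (ih₁.mul_left _) (ih₀.mul_left _)

/-- For `k ∈ {1,3,5}` and `l ≥ 6`, the integer `5^l · l! · P_l(k/5)` is divisible by 16. -/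
theorem legendre_rescaled_odd_divisible (k : ℕ) (hk : k ∈ ({1, 3, 5} : Set ℕ))
    (l : ℕ) (hl : 6 ≤ l) :
    ∃ z : ℤ, (z : ℝ) = (5 : ℝ) ^ l * (Nat.factorial l : ℝ) * legendreP l ((k : ℝ) / 5) ∧
      (16 : ℤ) ∣ z := by
  refine ⟨legendreRescaled k l, by simpa using legendreRescaled_cast k l, ?_⟩
  obtain ⟨n, rfl⟩ := Nat.exists_eq_add_of_le' hl
  simp only [Set.mem_insert_iff, Set.mem_singleton_iff] at hk
  rcases hk with rfl | rfl | rfl <;>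
    exact sixteen_dvd_legendreRescaled (by norm_num [legendreRescaled])
      (by norm_num [legendreRescaled]) n
end
end

section
/- Define c_l = P_l(1) + 3·P_l(4/5) + P_l(3/5) + 4·P_l(2/5) + 2·P_l(1/5) + P_l(0), where P_l is the Legendre polynomial of degree l. Then for every l ≥ 6, the number 5^l · l! · c_l is an integer that is not divisible by 16; in particular c_l ≠ 0 for l ≥ 6. -/
noncomputable section

/-- The integers `5^l · l! · P_l(k/5)`, through their recurrence. -/
def scaledLegendre (k : ℤ) : ℕ → ℤ
  | 0 => 1
  | 1 => k
  | l + 2 => (2 * (l : ℤ) + 3) * k * scaledLegendre k (l + 1)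
      - 25 * ((l : ℤ) + 1) ^ 2 * scaledLegendre k l

theorem scaledLegendre_cast (k : ℤ) (l : ℕ) :
    (scaledLegendre k l : ℝ) = 5 ^ l * (Nat.factorial l : ℝ) * legendreP l (k / 5) := by
  induction l using Nat.twoStepInduction with
  | zero => simp [scaledLegendre, legendreP]
  | one => simp [scaledLegendre, legendreP]; field_simp
  | more l ih₀ ih₁ =>
    have h : (l : ℝ) + 2 ≠ 0 := by positivity
    simp only [scaledLegendre, legendreP]
    push_cast [Nat.factorial_succ] at ih₁ ⊢
    rw [ih₀, ih₁]
    field_simp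
    ring

/-- Two consecutive congruences modulo 16 at distance 16 propagate to all larger indices. -/
theorem scaledLegendre_add_sixteen_modEq {k : ℤ} {m : ℕ}
    (h₀ : scaledLegendre k (m + 16) ≡ scaledLegendre k m [ZMOD 16])
    (h₁ : scaledLegendre k (m + 1 + 16) ≡ scaledLegendre k (m + 1) [ZMOD 16]) (n : ℕ) :
    scaledLegendre k (m + n + 16) ≡ scaledLegendre k (m + n) [ZMOD 16] := by
  induction n using Nat.twoStepInduction with
  | zero => exact h₀
  | one => exact h₁
  | more n ih₀ ih₁ =>
    have hl : ((m + n + 16 : ℕ) : ℤ) ≡ ((m + n : ℕ) : ℤ) [ZMOD 16] := by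
      push_cast
      exact Int.add_modEq_right
    exact (((((hl.mul_left 2).add_right 3).mul_right k).mul ih₁).sub
      ((((hl.add_right 1).pow 2).mul_left 25).mul ih₀))

/-- The integers `5^l · l! · c_l`. -/
def scaledLegendreC (l : ℕ) : ℤ :=
  scaledLegendre 5 l + 3 * scaledLegendre 4 l + scaledLegendre 3 l
    + 4 * scaledLegendre 2 l + 2 * scaledLegendre 1 l + scaledLegendre 0 l

theorem scaledLegendreC_cast (l : ℕ) :
    (scaledLegendreC l : ℝ) = 5 ^ l * (Nat.factorial l : ℝ) * legendreC l := by
  simp only [scaledLegendreC, legendreC, Int.cast_add, Int.cast_mul, scaledLegendre_cast]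
  norm_num
  ring

theorem scaledLegendreC_add_sixteen_modEq (n : ℕ) :
    scaledLegendreC (6 + n + 16) ≡ scaledLegendreC (6 + n) [ZMOD 16] := by
  have h (k : ℤ) (hk : k ∈ Finset.Icc (0 : ℤ) 5) :
      scaledLegendre k (6 + n + 16) ≡ scaledLegendre k (6 + n) [ZMOD 16] := by
    have hbase : ∀ k ∈ Finset.Icc (0 : ℤ) 5,
        scaledLegendre k (6 + 16) ≡ scaledLegendre k 6 [ZMOD 16] ∧
        scaledLegendre k (6 + 1 + 16) ≡ scaledLegendre k (6 + 1) [ZMOD 16] := by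
      decide +kernel
    exact scaledLegendre_add_sixteen_modEq (hbase k hk).1 (hbase k hk).2 n
  exact (((((h 5 (by decide)).add ((h 4 (by decide)).mul_left 3)).add (h 3 (by decide))).add
    ((h 2 (by decide)).mul_left 4)).add ((h 1 (by decide)).mul_left 2)).add (h 0 (by decide))

theorem not_sixteen_dvd_scaledLegendreC (n : ℕ) : ¬ (16 : ℤ) ∣ scaledLegendreC (6 + n) := by
  induction n using Nat.strong_induction_on with
  | _ n ih =>
    by_cases hn : n < 16
    · have hbase : ∀ n < 16, ¬ (16 : ℤ) ∣ scaledLegendreC (6 + n) := by decide +kernel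
      exact hbase n hn
    · obtain ⟨m, rfl⟩ := Nat.exists_eq_add_of_le' (not_lt.mp hn)
      rw [← add_assoc, (scaledLegendreC_add_sixteen_modEq m).dvd_iff]
      exact ih m (by omega)

/-- For `l ≥ 6`, the number `5^l · l! · c_l` is an integer not divisible by 16;
in particular `c_l ≠ 0`. -/
theorem legendreC_not_divisible (l : ℕ) (hl : 6 ≤ l) :
    (∃ z : ℤ, (z : ℝ) = (5 : ℝ) ^ l * (Nat.factorial l : ℝ) * legendreC l ∧
      ¬ (16 : ℤ) ∣ z) ∧ legendreC l ≠ 0 := by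
  have hdvd : ¬ (16 : ℤ) ∣ scaledLegendreC l := by
    obtain ⟨n, rfl⟩ := Nat.exists_eq_add_of_le hl
    exact not_sixteen_dvd_scaledLegendreC n
  refine ⟨⟨scaledLegendreC l, scaledLegendreC_cast l, hdvd⟩, fun h ↦ hdvd ?_⟩
  have hzero : scaledLegendreC l = 0 := by
    rw [← Int.cast_eq_zero (α := ℝ), scaledLegendreC_cast, h, mul_zero]
  simp [hzero]
end
end

section
/- Let S₁,…,S_m be n-dimensional simplices in ℝⁿ, each with its vertices on the unit sphere and its circumcenter at the origin, and let Q_{S₁},…,Q_{S_m} be the associated symmetric maps. If the set {Q_{S₁},…,Q_{S_m}} is not semi-eutactic, then for every ε > 0 there exists a positive-definite symmetric linear map T : ℝⁿ → ℝⁿ with ‖T − Id‖ < ε, det T > 1, and cr(T·Sᵢ) < 1 for every i = 1,…,m. -/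
open Set Pointwise MeasureTheory
open scoped RealInnerProductSpace

noncomputable section

abbrev Euc (n : ℕ) := EuclideanSpace ℝ (Fin n)

/-- The symmetric map `Q_S` associated to a simplex `S` with vertices `x j` on the unit
sphere and barycentric coordinates `α j` of the circumcenter:
`Q_S(v) = Σⱼ αⱼ ⟨xⱼ, v⟩ xⱼ`. -/
def QS {n : ℕ} (x : Fin (n + 1) → Euc n) (α : Fin (n + 1) → ℝ) : Euc n →ₗ[ℝ] Euc n :=
  ∑ j, α j • ((innerSL ℝ (x j)).toLinearMap.smulRight (x j))

/-- The Hilbert-Schmidt (Frobenius) norm of a linear map: `√(trace (Mᵀ ∘ M))`. -/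
def hsNorm {n : ℕ} (M : Euc n →ₗ[ℝ] Euc n) : ℝ :=
  Real.sqrt (LinearMap.trace ℝ (Euc n) (LinearMap.adjoint M ∘ₗ M))

theorem exists_isSymmetric_inner_eq_rankOne {E : Type*} [NormedAddCommGroup E]
    [InnerProductSpace ℝ E] [FiniteDimensional ℝ E] (f : (E →L[ℝ] E) →ₗ[ℝ] ℝ) :
    ∃ A : E →ₗ[ℝ] E, A.IsSymmetric ∧
      (∀ v, ⟪A v, v⟫ = f (InnerProductSpace.rankOne ℝ v v)) ∧
      LinearMap.trace ℝ E A = f (ContinuousLinearMap.id ℝ E) := by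
  let e := stdOrthonormalBasis ℝ E
  let B : E → E → ℝ := fun v w => f (InnerProductSpace.rankOne ℝ v w)
  have hBadd : ∀ u v w, B (u + v) w = B u w + B v w := fun u v w => by simp [B]
  have hBadd' : ∀ u v w, B w (u + v) = B w u + B w v := fun u v w => by simp [B]
  have hBsmul : ∀ (c : ℝ) v w, B (c • v) w = c * B v w := fun c v w => by simp [B]
  have hBsmul' : ∀ (c : ℝ) v w, B w (c • v) = c * B w v := fun c v w => by simp [B]
  let C : E →ₗ[ℝ] E →ₗ[ℝ] ℝ := LinearMap.mk₂ ℝ (fun v w => (B v w + B w v) / 2)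
    (fun u v w => by simp only [hBadd, hBadd']; ring)
    (fun c v w => by simp only [hBsmul, hBsmul', smul_eq_mul]; ring)
    (fun u v w => by simp only [hBadd, hBadd']; ring)
    (fun c v w => by simp only [hBsmul, hBsmul', smul_eq_mul]; ring)
  let A : E →ₗ[ℝ] E := ∑ i, (C (e i)).smulRight (e i)
  have hC : ∀ v w, C v w = C w v := fun v w => by simp only [C, LinearMap.mk₂_apply]; ring
  have hA : ∀ v w, ⟪A v, w⟫ = C v w := fun v w => by
    conv_rhs => rw [hC, ← e.sum_repr w]
    simp [A, sum_inner, inner_smul_left, e.repr_apply_apply, mul_comm]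
  have hAv : ∀ v, ⟪A v, v⟫ = f (InnerProductSpace.rankOne ℝ v v) := fun v => by
    rw [hA]; simp [C, B]
  refine ⟨A, fun v w => by rw [hA, real_inner_comm, hA, hC], hAv, ?_⟩
  rw [LinearMap.trace_eq_sum_inner A e]
  have hid : ContinuousLinearMap.id ℝ E = ∑ i, InnerProductSpace.rankOne ℝ (e i) (e i) := by
    ext v
    simp [← e.repr_apply_apply, e.sum_repr]
  rw [hid, map_sum]
  exact Finset.sum_congr rfl fun i _ => by rw [real_inner_comm, hAv]

theorem exists_convex_separation {ι V : Type*} [Fintype ι] [NormedAddCommGroup V] [NormedSpace ℝ V]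
    (Q : ι → V) (p : V) (hp : ¬ ∃ w ∈ stdSimplex ℝ ι, ∑ i, w i • Q i = p) :
    ∃ (f : V →L[ℝ] ℝ) (u : ℝ), (∀ i, f (Q i) < u) ∧ u < f p := by
  classical
  let L : (ι → ℝ) →ₗ[ℝ] V := ∑ i, (LinearMap.proj i : (ι → ℝ) →ₗ[ℝ] ℝ).smulRight (Q i)
  have hL : ∀ w, L w = ∑ i, w i • Q i := fun w => by simp [L]
  have hcomp : IsCompact (L '' stdSimplex ℝ ι) :=
    (isCompact_stdSimplex ℝ ι).image L.continuous_of_finiteDimensional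
  obtain ⟨f, u, hf, hu⟩ := geometric_hahn_banach_closed_point
    ((convex_stdSimplex ℝ ι).linear_image L) hcomp.isClosed (x := p)
    (by rintro ⟨w, hw, h⟩; exact hp ⟨w, hw, by rw [← hL, h]⟩)
  refine ⟨f, u, fun i => hf _ ⟨Pi.single i 1, single_mem_stdSimplex ℝ i, ?_⟩, hu⟩
  simp [hL, Pi.single_apply, ite_smul]

theorem AffineIndependent.exists_linearMap_eq {ι k V W : Type*} [Field k] [AddCommGroup V]
    [Module k V] [AddCommGroup W] [Module k W] {x : ι → V} (hx : AffineIndependent k x) (j₀ : ι)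
    (h : ι → W) : ∃ g : V →ₗ[k] W, ∀ j, g (x j - x j₀) = h j - h j₀ := by
  rw [affineIndependent_iff_linearIndependent_vsub k x j₀] at hx
  let b := Module.Basis.span hx
  obtain ⟨g, hg⟩ := (b.constr k fun j => h j - h j₀).exists_extend
  refine ⟨g, fun j => ?_⟩
  by_cases hj : j = j₀
  · simp [hj]
  have := LinearMap.congr_fun hg (b ⟨j, hj⟩)
  rwa [b.constr_basis, LinearMap.comp_apply, Submodule.subtype_apply,
    Module.Basis.span_apply] at this

theorem AffineIndependent.exists_inner_eq {ι E : Type*} [Fintype ι] [NormedAddCommGroup E]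
    [InnerProductSpace ℝ E] [FiniteDimensional ℝ E] {x : ι → E} (hx : AffineIndependent ℝ x)
    {α : ι → ℝ} (hα1 : ∑ j, α j = 1) (hα0 : ∑ j, α j • x j = 0) (h : ι → ℝ) :
    ∃ d : E, ∀ j, ⟪x j, d⟫ = h j - ∑ k, α k * h k := by
  obtain ⟨j₀⟩ : Nonempty ι := by
    by_contra hne
    rw [not_nonempty_iff] at hne
    simp at hα1
  obtain ⟨g, hg⟩ := hx.exists_linearMap_eq j₀ h
  have hgj : ∀ j, g (x j) = h j + (g (x j₀) - h j₀) := fun j => by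
    have := hg j
    rw [map_sub] at this
    linarith
  have hsum : ∑ k, α k * h k + (g (x j₀) - h j₀) = 0 := by
    have : ∑ j, α j * g (x j) = 0 := by simpa using congrArg g hα0
    rw [← this, Finset.sum_congr rfl fun j _ => congrArg (α j * ·) (hgj j)]
    simp only [mul_add, Finset.sum_add_distrib, ← Finset.sum_mul, hα1, one_mul]
  refine ⟨(InnerProductSpace.toDual ℝ E).symm g.toContinuousLinearMap, fun j => ?_⟩
  rw [real_inner_comm, InnerProductSpace.toDual_symm_apply]
  rw [LinearMap.coe_toContinuousLinearMap', hgj]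
  linarith

theorem LinearMap.eventually_one_lt_det_id_add_smul {E : Type*} [AddCommGroup E] [Module ℝ E]
    [FiniteDimensional ℝ E] {A : E →ₗ[ℝ] E} (hA : 0 < LinearMap.trace ℝ E A) :
    ∀ᶠ t : ℝ in nhdsWithin 0 (Ioi 0), 1 < LinearMap.det (LinearMap.id + t • A) := by
  let b := Module.finBasis ℝ E
  let M := LinearMap.toMatrix b b A
  have hdet : ∀ t : ℝ, LinearMap.det (LinearMap.id + t • A) =
      1 + M.trace * t +
        (Matrix.det (1 + (Polynomial.X : Polynomial ℝ) • M.map Polynomial.C)).divX.divX.eval t *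
          t ^ 2 := fun t => by
    rw [← Matrix.det_one_add_smul, ← LinearMap.det_toMatrix b]
    simp [M]
  rw [LinearMap.trace_eq_matrix_trace ℝ b] at hA
  set P := (Matrix.det (1 + (Polynomial.X : Polynomial ℝ) • M.map Polynomial.C)).divX.divX
  have hlim : ∀ᶠ t : ℝ in nhds 0, 0 < M.trace + P.eval t * t := by
    refine ContinuousAt.eventually_lt continuousAt_const ?_ (by simpa using hA)
    exact (continuous_const.add (P.continuous.mul continuous_id)).continuousAt
  filter_upwards [hlim.filter_mono nhdsWithin_le_nhds, self_mem_nhdsWithin] with t ht ht0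
  rw [hdet]
  nlinarith [mul_pos ht0 ht]

theorem hsNorm_smul {n : ℕ} (t : ℝ) (M : Euc n →ₗ[ℝ] Euc n) :
    hsNorm (t • M) = |t| * hsNorm M := by
  have : LinearMap.adjoint (t • M) ∘ₗ (t • M) = (t * t) • (LinearMap.adjoint M ∘ₗ M) := by
    simp [LinearMap.smul_comp, LinearMap.comp_smul, smul_smul]
  rw [hsNorm, this, map_smul, smul_eq_mul, Real.sqrt_mul (mul_self_nonneg t),
    Real.sqrt_mul_self_eq_abs, hsNorm]

theorem QS_toContinuousLinearMap {n : ℕ} (x : Fin (n + 1) → Euc n) (α : Fin (n + 1) → ℝ) :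
    LinearMap.toContinuousLinearMap (QS x α) =
      ∑ j, α j • InnerProductSpace.rankOne ℝ (x j) (x j) := by
  ext1 v
  simp [QS]

/-- If the `QS (x i) (α i)` are not semi-eutactic, some symmetric map of positive trace pairs
negatively with all of them. -/
theorem exists_isSymmetric_trace_pos {n m : ℕ} (x : Fin m → Fin (n + 1) → Euc n)
    (hx : ∀ i j, ‖x i j‖ = 1) (α : Fin m → Fin (n + 1) → ℝ) (hα1 : ∀ i, ∑ j, α i j = 1)
    (hnoteut : ¬ ∃ υ : Fin m → ℝ, (∀ i, 0 ≤ υ i) ∧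
        ∑ i, υ i • QS (x i) (α i) = LinearMap.id) :
    ∃ A : Euc n →ₗ[ℝ] Euc n, A.IsSymmetric ∧ 0 < LinearMap.trace ℝ (Euc n) A ∧
      ∀ i, ∑ j, α i j * ⟪A (x i j), x i j⟫ < 0 := by
  have hn : n ≠ 0 := by
    rintro rfl
    exact hnoteut ⟨0, fun _ => le_rfl, Subsingleton.elim _ _⟩
  have hn' : (0 : ℝ) < n := by positivity
  obtain ⟨f, u, hf, hu⟩ := exists_convex_separation
    (fun i => LinearMap.toContinuousLinearMap (QS (x i) (α i)))
    ((n : ℝ)⁻¹ • ContinuousLinearMap.id ℝ (Euc n)) (by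
      rintro ⟨w, hw, h⟩
      refine hnoteut ⟨fun i => n * w i, fun i => mul_nonneg hn'.le (hw.1 i), ?_⟩
      apply LinearMap.toContinuousLinearMap.injective
      simp only [mul_smul, ← Finset.smul_sum, map_smul, map_sum]
      rw [h, smul_smul, mul_inv_cancel₀ hn'.ne', one_smul]
      rfl)
  obtain ⟨A, hA, hAf, hAtr⟩ := exists_isSymmetric_inner_eq_rankOne f.toLinearMap
  refine ⟨A - u • LinearMap.id, hA.sub (LinearMap.IsSymmetric.id.smul (by simp)), ?_, fun i => ?_⟩
  · rw [map_smul, smul_eq_mul, inv_mul_eq_div, lt_div_iff₀ hn'] at hu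
    rw [map_sub, hAtr, map_smul, LinearMap.trace_id]
    simpa using hu
  · have h := hf i
    simp only [QS_toContinuousLinearMap, map_sum, map_smul, smul_eq_mul] at h
    have hterm : ∀ j, α i j * ⟪(A - u • LinearMap.id : Euc n →ₗ[ℝ] Euc n) (x i j), x i j⟫ =
        α i j * f (InnerProductSpace.rankOne ℝ (x i j) (x i j)) - α i j * u := fun j => by
      simp [inner_sub_left, inner_smul_left, hAf, hx, mul_sub]
    rw [Finset.sum_congr rfl fun j _ => hterm j, Finset.sum_sub_distrib, ← Finset.sum_mul,
      hα1, one_mul]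
    linarith

theorem half_norm_sq_le_inner_id_add_smul {E : Type*} [NormedAddCommGroup E]
    [InnerProductSpace ℝ E] [FiniteDimensional ℝ E] (A : E →ₗ[ℝ] E) {t : ℝ} (ht : 0 ≤ t)
    (htA : t * ‖LinearMap.toContinuousLinearMap A‖ ≤ 1 / 2) (v : E) :
    ‖v‖ ^ 2 / 2 ≤ ⟪(LinearMap.id + t • A : E →ₗ[ℝ] E) v, v⟫ := by
  have h1 : |⟪A v, v⟫| ≤ ‖LinearMap.toContinuousLinearMap A‖ * ‖v‖ * ‖v‖ :=
    (abs_real_inner_le_norm _ _).trans (by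
      gcongr; exact (LinearMap.toContinuousLinearMap A).le_opNorm v)
  have h2 := mul_le_mul_of_nonneg_left (neg_le_of_abs_le h1) ht
  have h3 := mul_le_mul_of_nonneg_right htA (sq_nonneg ‖v‖)
  simp only [LinearMap.add_apply, LinearMap.id_apply, LinearMap.smul_apply, inner_add_left,
    inner_smul_left, real_inner_self_eq_norm_sq, conj_trivial]
  linarith

/-- A simplex inscribed in the unit sphere shrinks its circumradius below `1` under small
perturbations of the identity in the direction of `A`, if `A` pairs negatively with it. -/
theorem eventually_circumradius_lt_one {ι E : Type*} [Fintype ι] [NormedAddCommGroup E]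
    [InnerProductSpace ℝ E] [FiniteDimensional ℝ E] {x : ι → E} (hx : ∀ j, ‖x j‖ = 1)
    (haff : AffineIndependent ℝ x) {α : ι → ℝ} (hα1 : ∑ j, α j = 1) (hα0 : ∑ j, α j • x j = 0)
    {A : E →ₗ[ℝ] E} (hA : A.IsSymmetric) (hAx : ∑ j, α j * ⟪A (x j), x j⟫ < 0) :
    ∀ᶠ t : ℝ in nhdsWithin 0 (Ioi 0), ∃ (c : E) (R : ℝ),
      (∀ j, dist ((LinearMap.id + t • A : E →ₗ[ℝ] E) (x j)) c = R) ∧ R < 1 := by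
  obtain ⟨d, hd⟩ := haff.exists_inner_eq hα1 hα0 fun j => ⟪A (x j), x j⟫
  obtain ⟨e, he⟩ := haff.exists_inner_eq hα1 hα0 fun j => ‖A (x j)‖ ^ 2 / 2
  set a := ∑ j, α j * ⟪A (x j), x j⟫
  set b := ∑ j, α j * (‖A (x j)‖ ^ 2 / 2)
  have hsmall : ∀ᶠ t : ℝ in nhds 0, t * ‖LinearMap.toContinuousLinearMap A‖ < 1 / 2 :=
    ContinuousAt.eventually_lt (by fun_prop) continuousAt_const (by simp)
  have hneg : ∀ᶠ t : ℝ in nhds 0, 2 * a + 2 * t * b + 4 * t * ‖d + t • e‖ ^ 2 < 0 :=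
    ContinuousAt.eventually_lt (by fun_prop) continuousAt_const (by simpa using mul_neg_of_pos_of_neg two_pos hAx)
  filter_upwards [hsmall.filter_mono nhdsWithin_le_nhds, hneg.filter_mono nhdsWithin_le_nhds,
    self_mem_nhdsWithin] with t ht hlt (ht0 : 0 < t)
  set T : E →ₗ[ℝ] E := LinearMap.id + t • A with hT
  have hcoer : ∀ v, ‖v‖ ^ 2 / 2 ≤ ⟪T v, v⟫ :=
    half_norm_sq_le_inner_id_add_smul A ht0.le ht.le
  have hbound : ∀ v, ‖v‖ ≤ 2 * ‖T v‖ := fun v => by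
    have h := (hcoer v).trans (real_inner_le_norm _ _)
    rcases (norm_nonneg v).eq_or_lt with h0 | h0
    · rw [← h0]; positivity
    · nlinarith
  have hinj : Function.Injective T := by
    rw [← LinearMap.ker_eq_bot, LinearMap.ker_eq_bot']
    intro v hv
    simpa [hv] using hbound v
  obtain ⟨c, hc⟩ := LinearMap.surjective_of_injective hinj (t • d + t ^ 2 • e)
  have hTsymm : ∀ v w, ⟪T v, w⟫ = ⟪v, T w⟫ := fun v w => by
    simp [hT, inner_add_left, inner_add_right, inner_smul_left, inner_smul_right, hA v w]
  have hcnorm : ‖c‖ ≤ 2 * (t * ‖d + t • e‖) := by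
    refine (hbound c).trans_eq ?_
    rw [hc, pow_two, mul_smul, ← smul_add, norm_smul, Real.norm_of_nonneg ht0.le]
  have hsq : ∀ j, ‖T (x j) - c‖ ^ 2 = 1 + 2 * t * a + 2 * t ^ 2 * b + ‖c‖ ^ 2 := fun j => by
    have h1 : ‖T (x j)‖ ^ 2 = 1 + 2 * t * ⟪A (x j), x j⟫ + t ^ 2 * ‖A (x j)‖ ^ 2 := by
      simp only [hT, LinearMap.add_apply, LinearMap.id_apply, LinearMap.smul_apply]
      rw [norm_add_sq_real, hx, inner_smul_right, norm_smul, real_inner_comm, mul_pow,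
        Real.norm_eq_abs, sq_abs]
      ring
    rw [norm_sub_sq_real, hTsymm, hc, inner_add_right, inner_smul_right, inner_smul_right, hd, he,
      h1]
    ring
  refine ⟨c, √(1 + 2 * t * a + 2 * t ^ 2 * b + ‖c‖ ^ 2), fun j => ?_, ?_⟩
  · rw [← hsq j, Real.sqrt_sq (norm_nonneg _), dist_eq_norm]
  · rw [Real.sqrt_lt' one_pos]
    have hc2 : ‖c‖ ^ 2 ≤ (2 * (t * ‖d + t • e‖)) ^ 2 := by gcongr
    have := mul_neg_of_pos_of_neg ht0 hlt
    nlinarith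

/-- If the maps `Q_{S₁}, …, Q_{S_m}` associated to simplices inscribed in the unit sphere
with circumcenters at the origin are *not* semi-eutactic, then for every `ε > 0` there is
a positive-definite symmetric `T` with `‖T − Id‖ < ε` (Hilbert-Schmidt norm), `det T > 1`,
and `cr(T·Sᵢ) < 1` for all `i`. -/
theorem not_semi_eutactic_exists_expansion {n m : ℕ} (x : Fin m → Fin (n + 1) → Euc n)
    (hx : ∀ i j, ‖x i j‖ = 1) (haff : ∀ i, AffineIndependent ℝ (x i))
    (α : Fin m → Fin (n + 1) → ℝ)
    (hα1 : ∀ i, ∑ j, α i j = 1) (hα0 : ∀ i, ∑ j, α i j • x i j = 0)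
    (hnoteut : ¬ ∃ υ : Fin m → ℝ, (∀ i, 0 ≤ υ i) ∧
        ∑ i, υ i • QS (x i) (α i) = LinearMap.id) :
    ∀ ε : ℝ, 0 < ε → ∃ T : Euc n →ₗ[ℝ] Euc n,
      T.IsSymmetric ∧ (∀ v : Euc n, v ≠ 0 → 0 < ⟪T v, v⟫) ∧
      hsNorm (T - LinearMap.id) < ε ∧ 1 < LinearMap.det T ∧
      ∀ i, ∃ (c : Euc n) (R : ℝ), (∀ j, dist (T (x i j)) c = R) ∧ R < 1 := by
  intro ε hε
  obtain ⟨A, hA, hAtr, hAneg⟩ := exists_isSymmetric_trace_pos x hx α hα1 hnoteut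
  have hcr := Filter.eventually_all.2 fun i =>
    eventually_circumradius_lt_one (hx i) (haff i) (hα1 i) (hα0 i) hA (hAneg i)
  have hsmall : ∀ᶠ t : ℝ in nhds 0, t * ‖LinearMap.toContinuousLinearMap A‖ < 1 / 2 :=
    ContinuousAt.eventually_lt (by fun_prop) continuousAt_const (by simp)
  have hnorm : ∀ᶠ t : ℝ in nhds 0, |t| * hsNorm A < ε :=
    ContinuousAt.eventually_lt (by fun_prop) continuousAt_const (by simpa using hε)
  obtain ⟨t, hcr, hdet, ht, hnorm, ht0⟩ := (hcr.and <|
    (LinearMap.eventually_one_lt_det_id_add_smul hAtr).and <|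
    (hsmall.filter_mono nhdsWithin_le_nhds).and <|
    (hnorm.filter_mono nhdsWithin_le_nhds).and self_mem_nhdsWithin).exists
  refine ⟨LinearMap.id + t • A, LinearMap.IsSymmetric.id.add (hA.smul (by simp)), fun v hv => ?_,
    ?_, hdet, hcr⟩
  · have := norm_pos_iff.2 hv
    exact lt_of_lt_of_le (by positivity)
      (half_norm_sq_le_inner_id_add_smul A (le_of_lt ht0) ht.le v)
  · rwa [add_sub_cancel_left, hsNorm_smul]
end
end

section
/- Let S₁,…,S_m be n-dimensional simplices in ℝⁿ, each with its vertices on the unit sphere and its circumcenter at the origin, and let Q_{S₁},…,Q_{S_m} be the associated symmetric maps. If the set {Q_{S₁},…,Q_{S_m}} is semi-eutactic, then every nonsingular linear map T : ℝⁿ → ℝⁿ satisfying cr(T·Sᵢ) ≤ 1 for all i = 1,…,m has |det T| ≤ 1. -/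
open Set Pointwise MeasureTheory
open scoped RealInnerProductSpace

noncomputable section

/-- A positive endomorphism whose trace is at most the dimension has determinant at most one. -/
theorem LinearMap.IsPositive.det_le_one_of_trace_le {E : Type*} [NormedAddCommGroup E]
    [InnerProductSpace ℝ E] [FiniteDimensional ℝ E] {A : E →ₗ[ℝ] E} (hA : A.IsPositive)
    (htr : LinearMap.trace ℝ E A ≤ Module.finrank ℝ E) : LinearMap.det A ≤ 1 := by
  have hdet := hA.isSymmetric.det_eq_prod_eigenvalues rfl
  have htrace := hA.isSymmetric.trace_eq_sum_eigenvalues rfl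
  simp only [RCLike.ofReal_real_eq_id] at hdet htrace
  rw [htrace] at htr
  rw [hdet]
  calc ∏ k, hA.isSymmetric.eigenvalues rfl k
      ≤ ∏ k, Real.exp (hA.isSymmetric.eigenvalues rfl k - 1) :=
        Finset.prod_le_prod (fun k _ ↦ hA.nonneg_eigenvalues rfl k) fun k _ ↦ by
          linarith [Real.add_one_le_exp (hA.isSymmetric.eigenvalues rfl k - 1)]
    _ = Real.exp (∑ k, (hA.isSymmetric.eigenvalues rfl k - 1)) := (Real.exp_sum _ _).symm
    _ ≤ 1 := by
        rw [Real.exp_le_one_iff, Finset.sum_sub_distrib]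
        simpa using htr

theorem trace_comp_QS {n : ℕ} (A : Euc n →ₗ[ℝ] Euc n) (x : Fin (n + 1) → Euc n)
    (α : Fin (n + 1) → ℝ) :
    LinearMap.trace ℝ (Euc n) (A ∘ₗ QS x α) = ∑ j, α j * ⟪x j, A (x j)⟫ := by
  have h : A ∘ₗ QS x α =
      ∑ j, α j • ((innerSL ℝ (x j)).toLinearMap.smulRight (A (x j))) := by
    ext1 v
    simp [QS]
  rw [h]
  simp [LinearMap.trace_smulRight]

/-- If the points `y j` lie on a sphere of radius at most one and have a vanishing affine
combination with weights `α j`, then the weighted sum of their squared norms is at most one. -/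
theorem sum_mul_norm_sq_le_one {ι E : Type*} [Fintype ι] [Nonempty ι] [NormedAddCommGroup E]
    [InnerProductSpace ℝ E] {y : ι → E} {α : ι → ℝ} (h1 : ∑ j, α j = 1)
    (h0 : ∑ j, α j • y j = 0) {c : E} {R : ℝ} (hR : ∀ j, dist (y j) c = R) (hR1 : R ≤ 1) :
    ∑ j, α j * ‖y j‖ ^ 2 ≤ 1 := by
  have hR0 : 0 ≤ R := hR (Classical.arbitrary ι) ▸ dist_nonneg
  have hterm : ∀ j, α j * ‖y j‖ ^ 2 = α j * (R ^ 2 - ‖c‖ ^ 2) + 2 * ⟪α j • y j, c⟫ := by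
    intro j
    rw [← hR j, dist_eq_norm, norm_sub_sq_real, real_inner_smul_left]
    ring
  rw [Finset.sum_congr rfl fun j _ ↦ hterm j, Finset.sum_add_distrib, ← Finset.sum_mul,
    ← Finset.mul_sum, ← sum_inner, h1, h0, inner_zero_left]
  nlinarith [sq_nonneg ‖c‖]

/-- If the maps `Q_{S₁}, …, Q_{S_m}` associated to simplices inscribed in the unit sphere
with circumcenters at the origin are semi-eutactic, then every nonsingular `T` with
`cr(T·Sᵢ) ≤ 1` for all `i` satisfies `|det T| ≤ 1`. -/
theorem semi_eutactic_det_le_one {n m : ℕ} (x : Fin m → Fin (n + 1) → Euc n)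
    (hx : ∀ i j, ‖x i j‖ = 1) (haff : ∀ i, AffineIndependent ℝ (x i))
    (α : Fin m → Fin (n + 1) → ℝ)
    (hα1 : ∀ i, ∑ j, α i j = 1) (hα0 : ∀ i, ∑ j, α i j • x i j = 0)
    (heut : ∃ υ : Fin m → ℝ, (∀ i, 0 ≤ υ i) ∧
        ∑ i, υ i • QS (x i) (α i) = LinearMap.id)
    (T : Euc n →ₗ[ℝ] Euc n) (hT : LinearMap.det T ≠ 0)
    (hcr : ∀ i, ∃ (c : Euc n) (R : ℝ), (∀ j, dist (T (x i j)) c = R) ∧ R ≤ 1) :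
    |LinearMap.det T| ≤ 1 := by
  obtain ⟨υ, hυ, hsum⟩ := heut
  have htrace : ∀ A : Euc n →ₗ[ℝ] Euc n, LinearMap.trace ℝ (Euc n) A =
      ∑ i, υ i * ∑ j, α i j * ⟪x i j, A (x i j)⟫ := by
    intro A
    have h : A = ∑ i, υ i • (A ∘ₗ QS (x i) (α i)) := by
      conv_lhs => rw [← LinearMap.comp_id A, ← hsum]
      ext1 v
      simp
    conv_lhs => rw [h]
    simp [trace_comp_QS]
  have hυn : ∑ i, υ i = n := by
    have h := htrace LinearMap.id
    simpa [real_inner_self_eq_norm_sq, hx, hα1] using h.symm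
  have hpos := T.isPositive_adjoint_comp_self
  have hle : LinearMap.det (T.adjoint ∘ₗ T) ≤ 1 := by
    refine hpos.det_le_one_of_trace_le ?_
    rw [htrace, finrank_euclideanSpace_fin, ← hυn]
    refine Finset.sum_le_sum fun i _ ↦ mul_le_of_le_one_right (hυ i) ?_
    obtain ⟨c, R, hR, hR1⟩ := hcr i
    have h0 : ∑ j, α i j • T (x i j) = 0 := by
      simpa using congrArg T (hα0 i)
    simpa [LinearMap.adjoint_inner_right, real_inner_self_eq_norm_sq] using
      sum_mul_norm_sq_le_one (hα1 i) h0 hR hR1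
  have hadj : LinearMap.det T.adjoint = LinearMap.det T := by
    let b := EuclideanSpace.basisFun (Fin n) ℝ
    rw [← LinearMap.det_toMatrix b.toBasis, ← LinearMap.det_toMatrix b.toBasis,
      LinearMap.toMatrix_adjoint, Matrix.det_conjTranspose, star_trivial]
  rw [LinearMap.det_comp, hadj, ← sq] at hle
  exact sq_le_one_iff_abs_le_one _ |>.mp hle
end
end

section
/- For t ∈ (−1,1), let A_t be the operator taking an integrable function f on S² to the function A_t f(y) = the average of f over the circle {z ∈ S² : ⟨z,y⟩ = t} with respect to the normalized arclength measure on that circle, and let A_1 f(y) = f(y). Define Φ f = A_1 f + 3·A_{4/5} f + A_{3/5} f + 4·A_{2/5} f + 2·A_{1/5} f + A_0 f. Let Z be the space, with the L¹(σ) norm, of even integrable functions f on S² with vanishing degree-2 spherical-harmonic component (i.e., ∫_{S²} f(x)·⟨x, Ax⟩ dσ(x) = 0 for every symmetric traceless 3×3 matrix A). Then Φ maps Z into Z, Φ is a bounded operator on Z, Φ is one-to-one on Z, and Φ has a bounded inverse on Z: there exists c > 0 such that ‖Φ f‖_{L¹(σ)} ≥ c·‖f‖_{L¹(σ)} for all f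 ∈ Z. -/
open Set MeasureTheory
open scoped RealInnerProductSpace

noncomputable section

abbrev Euc3 := EuclideanSpace ℝ (Fin 3)

/-- The rotation-invariant probability measure `σ` on the unit sphere `S² ⊆ ℝ³`,
realized as the normalized 2-dimensional Hausdorff measure restricted to the sphere. -/
def sphereσ : Measure Euc3 :=
  (Measure.hausdorffMeasure 2 (Metric.sphere (0 : Euc3) 1))⁻¹ •
    (Measure.hausdorffMeasure 2).restrict (Metric.sphere (0 : Euc3) 1)

/-- The "north pole" `p = (1,0,0) ∈ S²`. -/
def pole : Euc3 := (WithLp.equiv 2 (Fin 3 → ℝ)).symm ![1, 0, 0]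

/-- The standard constant-speed parametrization of the circle
`{z ∈ S² : ⟨z, p⟩ = t}` at height `t` around the pole:
`θ ↦ (t, √(1−t²)cos θ, √(1−t²)sin θ)`. -/
def circlePt (t θ : ℝ) : Euc3 :=
  (WithLp.equiv 2 (Fin 3 → ℝ)).symm
    ![t, Real.sqrt (1 - t ^ 2) * Real.cos θ, Real.sqrt (1 - t ^ 2) * Real.sin θ]

/-- `Φ f = A₁ f + 3·A_{4/5} f + A_{3/5} f + 4·A_{2/5} f + 2·A_{1/5} f + A₀ f`. -/
def PhiOp (A : ℝ → (Euc3 → ℝ) → Euc3 → ℝ) (f : Euc3 → ℝ) : Euc3 → ℝ := fun y =>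
  A 1 f y + 3 * A (4/5) f y + A (3/5) f y + 4 * A (2/5) f y + 2 * A (1/5) f y + A 0 f y

/-- Membership in `Z`: integrable with respect to the normalized sphere measure `σ`, even,
and with vanishing degree-2 spherical-harmonic component. -/
def memZ (f : Euc3 → ℝ) : Prop :=
  Integrable f sphereσ ∧ (∀ x : Euc3, ‖x‖ = 1 → f (-x) = f x) ∧
  (∀ A : Matrix (Fin 3) (Fin 3) ℝ, A.IsSymm → A.trace = 0 →
    (∫ x, f x * ⟪x, Matrix.toEuclideanLin A x⟫ ∂sphereσ) = 0)

namespace SphereAvg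

instance fact_two_pi_pos : Fact (0 < 2 * Real.pi) := ⟨Real.two_pi_pos⟩

/-- The circle of angles. -/
abbrev Circ := AddCircle (2 * Real.pi)

/-- The normalized Haar measure on the circle of angles. -/
abbrev τ : Measure Circ := AddCircle.haarAddCircle

def cosA (θ : Circ) : ℝ := Real.Angle.cos θ

def sinA (θ : Circ) : ℝ := Real.Angle.sin θ

lemma cosA_coe (x : ℝ) : cosA (x : Circ) = Real.cos x := rfl

lemma sinA_coe (x : ℝ) : sinA (x : Circ) = Real.sin x := rfl

lemma continuous_cosA : Continuous cosA := Real.Angle.continuous_cos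

lemma continuous_sinA : Continuous sinA := Real.Angle.continuous_sin

lemma cosA_add (x y : Circ) : cosA (x + y) = cosA x * cosA y - sinA x * sinA y :=
  Real.Angle.cos_add x y

lemma sinA_add (x y : Circ) : sinA (x + y) = sinA x * cosA y + cosA x * sinA y :=
  Real.Angle.sin_add x y

lemma cosA_neg (x : Circ) : cosA (-x) = cosA x := Real.Angle.cos_neg x

lemma sinA_neg (x : Circ) : sinA (-x) = -sinA x := Real.Angle.sin_neg x

lemma cosA_sq_add_sinA_sq (x : Circ) : cosA x ^ 2 + sinA x ^ 2 = 1 :=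
  Real.Angle.cos_sq_add_sin_sq x

lemma integral_τ (f : Circ → ℝ) :
    ∫ θ, f θ ∂τ = (2 * Real.pi)⁻¹ * ∫ x in (0 : ℝ)..(2 * Real.pi), f (x : Circ) := by
  rw [AddCircle.integral_haarAddCircle, ← AddCircle.intervalIntegral_preimage _ 0]
  simp

lemma exists_angle {x y r : ℝ} (hr : 0 ≤ r) (h : x ^ 2 + y ^ 2 = r ^ 2) :
    ∃ α : Circ, x = r * cosA α ∧ y = r * sinA α := by
  have hn : ‖(⟨x, y⟩ : ℂ)‖ = r := by
    rw [Complex.norm_def, Complex.normSq_mk, ← sq, ← sq, h, Real.sqrt_sq hr]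
  refine ⟨((Complex.arg ⟨x, y⟩ : ℝ) : Circ), ?_, ?_⟩
  · rw [cosA_coe, ← hn, Complex.norm_mul_cos_arg]
  · rw [sinA_coe, ← hn, Complex.norm_mul_sin_arg]

/-- The point of the circle at height `t` around the pole with angle `θ`. -/
def circ (t : ℝ) (θ : Circ) : Euc3 :=
  !₂[t, Real.sqrt (1 - t ^ 2) * cosA θ, Real.sqrt (1 - t ^ 2) * sinA θ]

@[simp] lemma circ_zero (t : ℝ) (θ : Circ) : circ t θ 0 = t := rfl

@[simp] lemma circ_one (t : ℝ) (θ : Circ) : circ t θ 1 = Real.sqrt (1 - t ^ 2) * cosA θ := rfl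

@[simp] lemma circ_two (t : ℝ) (θ : Circ) : circ t θ 2 = Real.sqrt (1 - t ^ 2) * sinA θ := rfl

@[simp] lemma pole_zero : pole 0 = 1 := rfl

@[simp] lemma pole_one : pole 1 = 0 := rfl

@[simp] lemma pole_two : pole 2 = 0 := rfl

lemma circ_coe (t x : ℝ) : circ t (x : Circ) = circlePt t x := rfl

lemma norm_sq_eq (x : Euc3) : ‖x‖ ^ 2 = x 0 ^ 2 + x 1 ^ 2 + x 2 ^ 2 := by
  rw [EuclideanSpace.norm_sq_eq, Fin.sum_univ_three]
  simp

lemma inner_eq (x y : Euc3) : ⟪x, y⟫ = x 0 * y 0 + x 1 * y 1 + x 2 * y 2 := by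
  rw [PiLp.inner_apply, Fin.sum_univ_three]
  simp [mul_comm]

lemma norm_eq_one_iff (x : Euc3) : ‖x‖ = 1 ↔ x 0 ^ 2 + x 1 ^ 2 + x 2 ^ 2 = 1 := by
  rw [← norm_sq_eq, pow_eq_one_iff_of_nonneg (norm_nonneg x) two_ne_zero]

lemma ext3 {x y : Euc3} (h0 : x 0 = y 0) (h1 : x 1 = y 1) (h2 : x 2 = y 2) : x = y := by
  ext i
  fin_cases i
  exacts [h0, h1, h2]

lemma norm_pole : ‖pole‖ = 1 := by simp [norm_eq_one_iff]

lemma inner_pole (x : Euc3) : ⟪x, pole⟫ = x 0 := by simp [inner_eq]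

lemma one_sub_sq_nonneg {t : ℝ} (ht : |t| ≤ 1) : 0 ≤ 1 - t ^ 2 := by
  have := (sq_le_one_iff_abs_le_one t).2 ht
  linarith

lemma norm_circ {t : ℝ} (ht : |t| ≤ 1) (θ : Circ) : ‖circ t θ‖ = 1 := by
  rw [norm_eq_one_iff, circ_zero, circ_one, circ_two]
  have h := Real.sq_sqrt (one_sub_sq_nonneg ht)
  have h2 := cosA_sq_add_sinA_sq θ
  linear_combination (cosA θ ^ 2 + sinA θ ^ 2) * h + (1 - t ^ 2) * h2

lemma continuous_circ : Continuous fun q : ℝ × Circ => circ q.1 q.2 := by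
  have := continuous_cosA
  have := continuous_sinA
  refine (PiLp.continuous_toLp 2 _).comp (continuous_pi fun i => ?_)
  fin_cases i
  · exact continuous_fst
  · change Continuous fun q : ℝ × Circ => Real.sqrt (1 - q.1 ^ 2) * cosA q.2
    fun_prop
  · change Continuous fun q : ℝ × Circ => Real.sqrt (1 - q.1 ^ 2) * sinA q.2
    fun_prop

lemma abs_le_one_of_norm {x : Euc3} (hx : ‖x‖ = 1) : |x 0| ≤ 1 := by
  rw [← sq_le_one_iff_abs_le_one]
  rw [norm_eq_one_iff] at hx
  nlinarith [sq_nonneg (x 1), sq_nonneg (x 2)]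

/-- Every unit vector lies on some circle around the pole. -/
lemma exists_circ {x : Euc3} (hx : ‖x‖ = 1) : ∃ α, x = circ (x 0) α := by
  have h := one_sub_sq_nonneg (abs_le_one_of_norm hx)
  rw [norm_eq_one_iff] at hx
  obtain ⟨α, h1, h2⟩ := exists_angle (x := x 1) (y := x 2) (Real.sqrt_nonneg (1 - x 0 ^ 2))
    (by rw [Real.sq_sqrt h]; linarith)
  exact ⟨α, ext3 rfl h1 h2⟩

/-- The rotation carrying the pole to `circ t θ` whose remaining columns are the unit tangent
vectors in the directions of the meridian and of the parallel. -/
def frameIso (t : ℝ) (θ : Circ) (ht : |t| ≤ 1) : Euc3 →ₗᵢ[ℝ] Euc3 where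
  toFun x := !₂[t * x 0 - Real.sqrt (1 - t ^ 2) * x 1,
    (Real.sqrt (1 - t ^ 2) * x 0 + t * x 1) * cosA θ - x 2 * sinA θ,
    (Real.sqrt (1 - t ^ 2) * x 0 + t * x 1) * sinA θ + x 2 * cosA θ]
  map_add' x y := by
    refine ext3 ?_ ?_ ?_ <;> simp <;> ring
  map_smul' r x := by
    refine ext3 ?_ ?_ ?_ <;> simp <;> ring
  norm_map' x := by
    refine (sq_eq_sq₀ (norm_nonneg _) (norm_nonneg _)).1 ?_
    have h := Real.sq_sqrt (one_sub_sq_nonneg ht)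
    have h2 := cosA_sq_add_sinA_sq θ
    simp only [norm_sq_eq, LinearMap.coe_mk, AddHom.coe_mk, Matrix.cons_val]
    linear_combination ((Real.sqrt (1 - t ^ 2) * x 0 + t * x 1) ^ 2 + x 2 ^ 2) * h2 +
      (x 0 ^ 2 + x 1 ^ 2) * h

def frame (t : ℝ) (θ : Circ) (ht : |t| ≤ 1) : Euc3 ≃ₗᵢ[ℝ] Euc3 :=
  (frameIso t θ ht).toLinearIsometryEquiv rfl

lemma frame_apply (t : ℝ) (θ : Circ) (ht : |t| ≤ 1) (x : Euc3) :
    frame t θ ht x = !₂[t * x 0 - Real.sqrt (1 - t ^ 2) * x 1,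
    (Real.sqrt (1 - t ^ 2) * x 0 + t * x 1) * cosA θ - x 2 * sinA θ,
    (Real.sqrt (1 - t ^ 2) * x 0 + t * x 1) * sinA θ + x 2 * cosA θ] := rfl

lemma frame_pole (t : ℝ) (θ : Circ) (ht : |t| ≤ 1) : frame t θ ht pole = circ t θ := by
  refine ext3 ?_ ?_ ?_ <;> simp [frame_apply]

/-- The rotation by the angle `θ` around the pole. -/
def rot (θ : Circ) : Euc3 ≃ₗᵢ[ℝ] Euc3 := frame 1 θ (by simp)

lemma rot_circ (θ : Circ) (t : ℝ) (φ : Circ) : rot θ (circ t φ) = circ t (φ + θ) := by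
  refine ext3 ?_ ?_ ?_ <;> simp [rot, frame_apply, cosA_add, sinA_add] <;> ring

lemma frame_eq_rot (t : ℝ) (θ : Circ) (ht : |t| ≤ 1) (x : Euc3) :
    frame t θ ht x = rot θ (frame t 0 ht x) := by
  have h0 : cosA 0 = 1 := Real.Angle.cos_zero
  have h1 : sinA 0 = 0 := Real.Angle.sin_zero
  refine ext3 ?_ ?_ ?_ <;> simp [rot, frame_apply, h0, h1]

/-- A linear isometry fixing the pole acts on all circles around the pole by one and the same
measure-preserving transformation of the angle. -/
lemma exists_equiv_of_fix (S : Euc3 ≃ₗᵢ[ℝ] Euc3) (hS : S pole = pole) :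
    ∃ e : Circ ≃ᵐ Circ, MeasurePreserving e τ τ ∧ ∀ t θ, S (circ t θ) = circ t (e θ) := by
  set e₁ : Euc3 := !₂[0, 1, 0] with he₁
  set e₂ : Euc3 := !₂[0, 0, 1] with he₂
  have hc : ∀ t θ, circ t θ = t • pole + (Real.sqrt (1 - t ^ 2) * cosA θ) • e₁ +
      (Real.sqrt (1 - t ^ 2) * sinA θ) • e₂ := by
    intro t θ
    refine ext3 ?_ ?_ ?_ <;> simp [he₁, he₂]
  have hn₁ : ‖S e₁‖ = 1 := by rw [S.norm_map, norm_eq_one_iff]; simp [he₁]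
  have hn₂ : ‖S e₂‖ = 1 := by rw [S.norm_map, norm_eq_one_iff]; simp [he₂]
  have h₁ : S e₁ 0 = 0 := by
    rw [← inner_pole, ← hS, S.inner_map_map, inner_pole]; rfl
  have h₂ : S e₂ 0 = 0 := by
    rw [← inner_pole, ← hS, S.inner_map_map, inner_pole]; rfl
  have h₁₂ : ⟪S e₁, S e₂⟫ = 0 := by
    rw [S.inner_map_map, inner_eq]; simp [he₁, he₂]
  rw [norm_eq_one_iff] at hn₁ hn₂
  rw [inner_eq] at h₁₂
  rw [h₁] at hn₁ h₁₂
  rw [h₂] at hn₂ h₁₂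
  obtain ⟨α, ha, hb⟩ := exists_angle (x := S e₁ 1) (y := S e₁ 2) zero_le_one (by linarith)
  rw [one_mul] at ha hb
  have hα := cosA_sq_add_sinA_sq α
  rw [ha, hb] at h₁₂
  set x := S e₂ 1
  set y := S e₂ 2
  set ε := y * cosA α - x * sinA α with hε
  have hx : x = -ε * sinA α := by
    rw [hε]; linear_combination (-x) * hα + cosA α * h₁₂
  have hy : y = ε * cosA α := by
    rw [hε]; linear_combination (-y) * hα + sinA α * h₁₂
  have hε2 : ε ^ 2 = 1 := by
    rw [hx, hy] at hn₂
    linear_combination hn₂ - ε ^ 2 * hα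
  have hSc : ∀ t θ, S (circ t θ) = t • pole + (Real.sqrt (1 - t ^ 2) * cosA θ) • S e₁ +
      (Real.sqrt (1 - t ^ 2) * sinA θ) • S e₂ := by
    intro t θ
    rw [hc, map_add, map_add, map_smul, map_smul, map_smul, hS]
  rcases mul_self_eq_one_iff.1 ((sq ε).symm.trans hε2) with h | h
  · refine ⟨MeasurableEquiv.addRight α, measurePreserving_add_right τ α, fun t θ => ?_⟩
    rw [hSc]
    refine ext3 ?_ ?_ ?_
    · simp [h₁, h₂]
    · simp only [PiLp.add_apply, PiLp.smul_apply, smul_eq_mul, pole_one, circ_one,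
        MeasurableEquiv.coe_addRight, cosA_add]
      rw [ha, show S e₂ 1 = x from rfl, hx, h]; ring
    · simp only [PiLp.add_apply, PiLp.smul_apply, smul_eq_mul, pole_two, circ_two,
        MeasurableEquiv.coe_addRight, sinA_add]
      rw [hb, show S e₂ 2 = y from rfl, hy, h]; ring
  · refine ⟨(MeasurableEquiv.neg Circ).trans (MeasurableEquiv.addRight α),
      (measurePreserving_add_right τ α).comp (Measure.measurePreserving_neg τ), fun t θ => ?_⟩
    rw [hSc]
    refine ext3 ?_ ?_ ?_
    · simp [h₁, h₂]
    · simp only [PiLp.add_apply, PiLp.smul_apply, smul_eq_mul, pole_one, circ_one,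
        MeasurableEquiv.trans_apply, MeasurableEquiv.neg_apply,
        MeasurableEquiv.coe_addRight, cosA_add, cosA_neg, sinA_neg]
      rw [ha, show S e₂ 1 = x from rfl, hx, h]; ring
    · simp only [PiLp.add_apply, PiLp.smul_apply, smul_eq_mul, pole_two, circ_two,
        MeasurableEquiv.trans_apply, MeasurableEquiv.neg_apply,
        MeasurableEquiv.coe_addRight, sinA_add, cosA_neg, sinA_neg]
      rw [hb, show S e₂ 2 = y from rfl, hy, h]; ring

/-- The hyperplane reflection exchanging two unit vectors. -/
def swapIso (x y : Euc3) : Euc3 ≃ₗᵢ[ℝ] Euc3 := (ℝ ∙ (x - y))ᗮ.reflection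

lemma swapIso_left {x y : Euc3} (h : ‖x‖ = ‖y‖) : swapIso x y x = y :=
  Submodule.reflection_sub h

lemma swapIso_right {x y : Euc3} (h : ‖x‖ = ‖y‖) : swapIso x y y = x := by
  have := congrArg (swapIso x y) (swapIso_left h)
  rw [← this]
  exact Submodule.reflection_reflection _ _

lemma swapIso_apply (x y z : Euc3) :
    swapIso x y z = z - (2 * (⟪x - y, z⟫ / ‖x - y‖ ^ 2)) • (x - y) := by
  rw [swapIso, Submodule.reflection_orthogonal_apply, Submodule.reflection_singleton_apply]
  simp [two_smul, two_mul, add_smul]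

lemma exists_equiv {V W : Euc3 ≃ₗᵢ[ℝ] Euc3} (h : V pole = W pole) :
    ∃ e : Circ ≃ᵐ Circ, MeasurePreserving e τ τ ∧ ∀ t θ, V (circ t θ) = W (circ t (e θ)) := by
  obtain ⟨e, he, h'⟩ := exists_equiv_of_fix (V.trans W.symm) (by simp [h])
  refine ⟨e, he, fun t θ => ?_⟩
  rw [← h' t θ]
  simp

/-- The average over the circle at height `t` around `y`. -/
def avg (t : ℝ) (f : Euc3 → ℝ) (y : Euc3) : ℝ := ∫ θ, f (swapIso pole y (circ t θ)) ∂τ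

lemma avg_eq (V : Euc3 ≃ₗᵢ[ℝ] Euc3) (t : ℝ) (f : Euc3 → ℝ) :
    avg t f (V pole) = ∫ θ, f (V (circ t θ)) ∂τ := by
  obtain ⟨e, he, h⟩ := exists_equiv (V := V) (W := swapIso pole (V pole))
    (swapIso_left (by simp)).symm
  simp_rw [h]
  exact (he.integral_comp' (fun θ => f (swapIso pole (V pole) (circ t θ)))).symm

end SphereAvg

namespace SphereAvg

/-- The orthogonal group of `ℝ³`, as a topological group of operators. -/
abbrev Iso3 := unitary (Euc3 →L[ℝ] Euc3)

/-- The action of the orthogonal group. -/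
def act (U : Iso3) : Euc3 ≃ₗᵢ[ℝ] Euc3 := Unitary.linearIsometryEquiv U

lemma act_apply (U : Iso3) (x : Euc3) : act U x = (U : Euc3 →L[ℝ] Euc3) x := rfl

lemma act_mul (U V : Iso3) (x : Euc3) : act (U * V) x = act U (act V x) := rfl

lemma exists_act (V : Euc3 ≃ₗᵢ[ℝ] Euc3) : ∃ U, act U = V :=
  Unitary.linearIsometryEquiv.surjective V

lemma continuous_act : Continuous fun q : Iso3 × Euc3 => act q.1 q.2 := by
  simp_rw [act_apply]
  fun_prop

lemma measurable_act : Measurable fun q : Iso3 × Euc3 => act q.1 q.2 :=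
  continuous_act.measurable

instance continuousStar_operators : ContinuousStar (Euc3 →L[ℝ] Euc3) :=
  ⟨(ContinuousLinearMap.adjoint (𝕜 := ℝ) (E := Euc3) (F := Euc3)).continuous⟩

instance compactSpace_iso3 : CompactSpace Iso3 := by
  have hc : IsClosed (unitary (Euc3 →L[ℝ] Euc3) : Set (Euc3 →L[ℝ] Euc3)) := by
    have : (unitary (Euc3 →L[ℝ] Euc3) : Set (Euc3 →L[ℝ] Euc3)) =
        {U | star U * U = 1} ∩ {U | U * star U = 1} := by
      ext U
      simp [Unitary.mem_iff]
    rw [this]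
    exact (isClosed_eq (continuous_star.mul continuous_id) continuous_const).inter
      (isClosed_eq (continuous_id.mul continuous_star) continuous_const)
  refine isCompact_iff_compactSpace.1 (Metric.isCompact_of_isClosed_isBounded hc ?_)
  refine (Metric.isBounded_closedBall (x := (0 : Euc3 →L[ℝ] Euc3)) (r := 1)).subset ?_
  intro U hU
  rw [mem_closedBall_zero_iff]
  refine ContinuousLinearMap.opNorm_le_bound _ zero_le_one fun x => ?_
  rw [one_mul]
  exact ((act ⟨U, hU⟩).norm_map x).le

/-- The right-invariant probability measure on the orthogonal group. -/
def haarIso : Measure Iso3 :=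
  (Measure.haarMeasure (⊤ : TopologicalSpace.PositiveCompacts Iso3)).inv

instance : haarIso.IsMulRightInvariant := by unfold haarIso; infer_instance

instance : IsProbabilityMeasure haarIso := by
  constructor
  rw [haarIso, Measure.inv_apply]
  have := Measure.haarMeasure_self (K₀ := (⊤ : TopologicalSpace.PositiveCompacts Iso3))
  simpa using this

lemma _root_.MeasureTheory.MeasurePreserving.integral_comp_ae {α β : Type*} [MeasurableSpace α]
    [MeasurableSpace β] {μ : Measure α} {ν : Measure β} {φ : α → β} (m : MeasurePreserving φ μ ν)
    {f : β → ℝ} (hf : AEStronglyMeasurable f ν) : ∫ x, f (φ x) ∂μ = ∫ y, f y ∂ν := by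
  rw [← m.map_eq] at hf ⊢
  rw [integral_map m.measurable.aemeasurable hf]

/-- Rotation-invariant probability measures concentrated on the unit sphere. -/
structure IsSphereMeasure (σ : Measure Euc3) : Prop where
  prob : IsProbabilityMeasure σ
  norm : ∀ᵐ x ∂σ, ‖x‖ = 1
  inv : ∀ U : Euc3 ≃ₗᵢ[ℝ] Euc3, MeasurePreserving U σ σ

variable {σ : Measure Euc3}

lemma exists_iso_eq {x y : Euc3} (h : ‖x‖ = ‖y‖) : ∃ V : Iso3, act V x = y ∧ act V y = x := by
  obtain ⟨V, hV⟩ := exists_act (swapIso x y)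
  exact ⟨V, by rw [hV, swapIso_left h], by rw [hV, swapIso_right h]⟩

lemma measurable_act_left (x : Euc3) : Measurable fun U => act U x :=
  measurable_act.comp (measurable_id.prodMk measurable_const)

lemma haarIso_preimage_eq {x y : Euc3} (h : ‖x‖ = ‖y‖) {B : Set Euc3} (hB : MeasurableSet B) :
    haarIso {U | act U x ∈ B} = haarIso {U | act U y ∈ B} := by
  obtain ⟨V, hV, -⟩ := exists_iso_eq h
  have := (measurePreserving_mul_right haarIso V).measure_preimage
    ((measurable_act_left x) hB).nullMeasurableSet
  rw [show {U | act U x ∈ B} = (fun U => act U x) ⁻¹' B from rfl, ← this]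
  simp only [preimage, mem_ofPred_eq, act_mul, hV]

lemma IsSphereMeasure.map_act (hσ : IsSphereMeasure σ) {x : Euc3} (hx : ‖x‖ = 1) :
    MeasurePreserving (fun U => act U x) haarIso σ := by
  have := hσ.prob
  refine ⟨measurable_act_left x, Measure.ext fun B hB => ?_⟩
  rw [Measure.map_apply (measurable_act_left x) hB]
  have hm : MeasurableSet ((fun q : Iso3 × Euc3 => act q.1 q.2) ⁻¹' B) := measurable_act hB
  have h1 := Measure.prod_apply (μ := haarIso) (ν := σ) hm
  have h2 := Measure.prod_apply_symm (μ := haarIso) (ν := σ) hm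
  rw [h1] at h2
  have e1 : ∀ U, σ (Prod.mk U ⁻¹' ((fun q : Iso3 × Euc3 => act q.1 q.2) ⁻¹' B)) = σ B := by
    intro U
    exact (hσ.inv (act U)).measure_preimage hB.nullMeasurableSet
  have e2 : ∀ᵐ y ∂σ, haarIso ((fun U => (U, y)) ⁻¹' ((fun q : Iso3 × Euc3 => act q.1 q.2) ⁻¹' B))
      = haarIso ((fun U => act U x) ⁻¹' B) := by
    filter_upwards [hσ.norm] with y hy
    exact haarIso_preimage_eq (by rw [hx, hy]) hB
  rw [lintegral_congr e1, lintegral_congr_ae e2] at h2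
  simpa using h2.symm

section
variable {Ω : Type*} [MeasurableSpace Ω] {μ : Measure Ω} [IsProbabilityMeasure μ]

lemma IsSphereMeasure.map_act_prod (hσ : IsSphereMeasure σ) {z : Ω → Euc3} (hz : Measurable z)
    (hn : ∀ᵐ ω ∂μ, ‖z ω‖ = 1) :
    MeasurePreserving (fun q : Iso3 × Ω => act q.1 (z q.2)) (haarIso.prod μ) σ := by
  have hm : Measurable fun q : Iso3 × Ω => act q.1 (z q.2) :=
    measurable_act.comp (measurable_fst.prodMk (hz.comp measurable_snd))
  refine ⟨hm, Measure.ext fun B hB => ?_⟩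
  rw [Measure.map_apply hm hB, Measure.prod_apply_symm (hm hB)]
  have e : ∀ᵐ ω ∂μ, haarIso ((fun U => (U, ω)) ⁻¹' ((fun q : Iso3 × Ω => act q.1 (z q.2)) ⁻¹' B))
      = σ B := by
    filter_upwards [hn] with ω hω
    exact (hσ.map_act hω).measure_preimage hB.nullMeasurableSet
  rw [lintegral_congr_ae e]
  simp

end

lemma measurable_circ {t : ℝ} : Measurable (circ t) :=
  (continuous_circ.comp (by fun_prop : Continuous fun θ : Circ => (t, θ))).measurable

lemma measurable_avgMap (t : ℝ) :
    Measurable fun q : Euc3 × Circ => swapIso pole q.1 (circ t q.2) := by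
  have h := measurable_circ (t := t)
  simp_rw [swapIso_apply]
  fun_prop

lemma IsSphereMeasure.map_avgMap (hσ : IsSphereMeasure σ) {t : ℝ} (ht : |t| ≤ 1) :
    MeasurePreserving (fun q : Euc3 × Circ => swapIso pole q.1 (circ t q.2)) (σ.prod τ) σ := by
  refine ⟨measurable_avgMap t, Measure.ext fun B hB => ?_⟩
  have hm := measurable_avgMap t hB
  rw [Measure.map_apply (measurable_avgMap t) hB, Measure.prod_apply hm,
    ← (hσ.map_act norm_pole).lintegral_comp (measurable_measure_prodMk_left hm)]
  have h := hσ.map_act_prod (μ := τ) (measurable_circ (t := t))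
    (Filter.Eventually.of_forall (norm_circ ht))
  rw [← h.measure_preimage hB.nullMeasurableSet, Measure.prod_apply (h.measurable hB)]
  refine lintegral_congr fun U => ?_
  obtain ⟨e, he, h'⟩ := exists_equiv (V := act U) (W := swapIso pole (act U pole))
    (swapIso_left (by simp)).symm
  rw [← he.measure_preimage (measurable_prodMk_left hm).nullMeasurableSet]
  simp only [preimage, mem_ofPred_eq, h']

lemma IsSphereMeasure.integrable_avg (hσ : IsSphereMeasure σ) {t : ℝ} (ht : |t| ≤ 1)
    {f : Euc3 → ℝ} (hf : Integrable f σ) : Integrable (avg t f) σ := by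
  have := hσ.prob
  exact ((hσ.map_avgMap ht).integrable_comp_of_integrable hf).integral_prod_left

lemma IsSphereMeasure.integral_abs_avg_le (hσ : IsSphereMeasure σ) {t : ℝ} (ht : |t| ≤ 1)
    {f : Euc3 → ℝ} (hf : Integrable f σ) : ∫ x, |avg t f x| ∂σ ≤ ∫ x, |f x| ∂σ := by
  have := hσ.prob
  have h : Integrable (fun q : Euc3 × Circ => |f (swapIso pole q.1 (circ t q.2))|) (σ.prod τ) :=
    (hσ.map_avgMap ht).integrable_comp_of_integrable hf.abs
  have h2 := (hσ.map_avgMap ht).integral_comp_ae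
    (f := fun x => |f x|) hf.abs.aestronglyMeasurable
  rw [← h2, integral_prod _ h]
  refine integral_mono (hσ.integrable_avg ht hf).abs h.integral_prod_left fun y => ?_
  exact abs_integral_le_integral_abs

lemma IsSphereMeasure.ae_integrable_avg (hσ : IsSphereMeasure σ) {t : ℝ} (ht : |t| ≤ 1)
    {f : Euc3 → ℝ} (hf : Integrable f σ) :
    ∀ᵐ y ∂σ, Integrable (fun θ => f (swapIso pole y (circ t θ))) τ := by
  have := hσ.prob
  exact ((hσ.map_avgMap ht).integrable_comp_of_integrable hf).prod_right_ae

/-- The averaging operators are symmetric. -/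
lemma IsSphereMeasure.integral_avg_mul (hσ : IsSphereMeasure σ) {t : ℝ} (ht : |t| ≤ 1)
    {f g : Euc3 → ℝ} (hf : Integrable f σ) (hg : Continuous g) :
    ∫ y, avg t f y * g y ∂σ = ∫ y, f y * avg t g y ∂σ := by
  have := hσ.prob
  obtain ⟨C, hC⟩ := (isCompact_sphere (0 : Euc3) 1).exists_bound_of_continuousOn hg.continuousOn
  have hC' : ∀ x, ‖x‖ = 1 → ‖g x‖ ≤ C := fun x hx => hC x (by simpa using hx)
  have hcirc : ∀ᵐ θ ∂τ, ‖circ t θ‖ = 1 := Filter.Eventually.of_forall (norm_circ ht)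
  have hpole : ∀ᵐ θ : Circ ∂τ, ‖pole‖ = 1 := Filter.Eventually.of_forall fun _ => norm_pole
  have m1 := hσ.map_act_prod (μ := τ) (measurable_circ (t := t)) hcirc
  have m2 := hσ.map_act_prod (μ := τ) measurable_const hpole
  have i1 : Integrable (fun q : Iso3 × Circ => f (act q.1 (circ t q.2)) * g (act q.1 pole))
      (haarIso.prod τ) := by
    refine (m1.integrable_comp_of_integrable hf).mul_bdd (c := C)
      (hg.measurable.comp m2.measurable).aestronglyMeasurable
      (Filter.Eventually.of_forall fun q => hC' _ ?_)
    rw [LinearIsometryEquiv.norm_map, norm_pole]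
  have i2 : Integrable (fun q : Iso3 × Circ => f (act q.1 pole) * g (act q.1 (circ t q.2)))
      (haarIso.prod τ) := by
    refine (m2.integrable_comp_of_integrable hf).mul_bdd (c := C)
      (hg.measurable.comp m1.measurable).aestronglyMeasurable
      (Filter.Eventually.of_forall fun q => hC' _ ?_)
    rw [LinearIsometryEquiv.norm_map, norm_circ ht]
  have hgavg : AEStronglyMeasurable (avg t g) σ := by
    refine (Measurable.stronglyMeasurable ?_).aestronglyMeasurable
    exact ((hg.measurable.comp (measurable_avgMap t)).stronglyMeasurable.integral_prod_right'
      (ν := τ)).measurable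
  have m := hσ.map_act norm_pole
  rw [← m.integral_comp_ae (f := fun y => avg t f y * g y)
      ((hσ.integrable_avg ht hf).aestronglyMeasurable.mul hg.aestronglyMeasurable),
    ← m.integral_comp_ae (f := fun y => f y * avg t g y) (hf.aestronglyMeasurable.mul hgavg)]
  simp only [avg_eq, ← integral_mul_const, ← integral_const_mul]
  refine (integral_integral_swap i1).trans (Eq.trans ?_ (integral_integral_swap i2).symm)
  refine integral_congr_ae (Filter.Eventually.of_forall fun θ => ?_)
  obtain ⟨V, h1, h2⟩ := exists_iso_eq (x := pole) (y := circ t θ) (by rw [norm_pole, norm_circ ht])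
  refine (integral_mul_right_eq_self (fun U => f (act U (circ t θ)) * g (act U pole)) V).symm.trans ?_
  simp only [act_mul, h1, h2]

end SphereAvg

namespace SphereAvg

variable {σ : Measure Euc3}

lemma measurable_cosA : Measurable cosA := continuous_cosA.measurable

lemma τ_eq_zero_iff {S : Set Circ} (hS : MeasurableSet S) :
    τ S = 0 ↔ volume {x : ℝ | x ∈ Ioc (-Real.pi) Real.pi ∧ (x : Circ) ∈ S} = 0 := by
  have h1 := (AddCircle.measurePreserving_mk (2 * Real.pi) (-Real.pi)).measure_preimage
    hS.nullMeasurableSet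
  rw [Measure.restrict_apply (AddCircle.measurable_mk' hS),
    show -Real.pi + 2 * Real.pi = Real.pi by ring] at h1
  rw [show {x : ℝ | x ∈ Ioc (-Real.pi) Real.pi ∧ (x : Circ) ∈ S} =
    (fun x : ℝ => (x : Circ)) ⁻¹' S ∩ Ioc (-Real.pi) Real.pi by ext x; simp [and_comm]]
  rw [h1, AddCircle.volume_eq_smul_haarAddCircle]
  simp [Real.pi_pos]

/-- The law of an affine function of the cosine of a uniform angle has the same null sets as
Lebesgue measure on an interval. -/
lemma τ_cosA_eq_zero_iff {a b : ℝ} (hb : b ≠ 0) {B : Set ℝ} (hB : MeasurableSet B) :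
    τ {θ | a + b * cosA θ ∈ B} = 0 ↔ volume (B ∩ {w | |w - a| ≤ |b|}) = 0 := by
  have hb' : 0 < |b| := abs_pos.2 hb
  have hm : MeasurableSet {θ | a + b * cosA θ ∈ B} :=
    (measurable_const.add (measurable_cosA.const_mul b)) hB
  rw [τ_eq_zero_iff hm]
  simp only [mem_ofPred_eq, cosA_coe]
  constructor
  · intro h
    refine measure_mono_null ?_ (addHaar_image_eq_zero_of_differentiableOn_of_addHaar_eq_zero
      volume (f := fun x : ℝ => a + b * Real.cos x) (by fun_prop) h)
    rintro w ⟨hw, hw'⟩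
    have h2 : |(w - a) / b| ≤ 1 := by
      rw [abs_div, div_le_one hb']; exact hw'
    rw [abs_le] at h2
    have h3 : a + b * Real.cos (Real.arccos ((w - a) / b)) = w := by
      rw [Real.cos_arccos h2.1 h2.2]; field_simp; ring
    refine ⟨Real.arccos ((w - a) / b), ⟨⟨?_, Real.arccos_le_pi _⟩, ?_⟩, h3⟩
    · linarith [Real.arccos_nonneg ((w - a) / b), Real.pi_pos]
    · rw [h3]; exact hw
  · intro h
    have h0 : volume (B ∩ {w | |w - a| < |b|}) = 0 :=
      by
      refine measure_mono_null ?_ h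
      exact fun w hw => ⟨hw.1, (show |w - a| < |b| from hw.2).le⟩
    have hlt : ∀ w ∈ B ∩ {w | |w - a| < |b|}, |(w - a) / b| < 1 := by
      rintro w ⟨-, hw⟩
      rw [abs_div, div_lt_one hb']; exact hw
    have hd : DifferentiableOn ℝ (fun w => Real.arccos ((w - a) / b))
        (B ∩ {w | |w - a| < |b|}) := by
      intro w hw
      have := abs_lt.1 (hlt w hw)
      exact (DifferentiableAt.comp w (Real.differentiableAt_arccos.2 ⟨this.1.ne', this.2.ne⟩)
        (by fun_prop)).differentiableWithinAt
    have e1 := addHaar_image_eq_zero_of_differentiableOn_of_addHaar_eq_zero volume hd h0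
    have e2 := addHaar_image_eq_zero_of_differentiableOn_of_addHaar_eq_zero volume hd.neg h0
    refine measure_mono_null ?_ (measure_union_null (measure_union_null e1 e2)
      ((Set.toFinite ({0, Real.pi} : Set ℝ)).measure_zero volume))
    rintro x ⟨⟨hx1, hx2⟩, hx⟩
    by_cases h : x = 0 ∨ x = Real.pi
    · right; simpa using h
    left
    push Not at h
    have hs : Real.sin x ≠ 0 := by
      rcases lt_or_gt_of_ne h.1 with h' | h'
      · exact (Real.sin_neg_of_neg_of_neg_pi_lt h' hx1).ne
      · exact (Real.sin_pos_of_pos_of_lt_pi h' (lt_of_le_of_ne hx2 h.2)).ne'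
    have hc : |Real.cos x| < 1 := by
      rw [← sq_lt_one_iff_abs_lt_one]
      have := sq_pos_of_ne_zero hs
      nlinarith [Real.sin_sq_add_cos_sq x]
    have hmem : a + b * Real.cos x ∈ B ∩ {w | |w - a| < |b|} := by
      refine ⟨hx, ?_⟩
      rw [mem_ofPred_eq, add_sub_cancel_left, abs_mul]
      exact mul_lt_of_lt_one_right hb' hc
    have he : (a + b * Real.cos x - a) / b = Real.cos x := by field_simp; ring
    rcases le_total 0 x with h' | h'
    · left
      refine ⟨_, hmem, ?_⟩
      simp only [he]
      exact Real.arccos_cos h' hx2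
    · right
      refine ⟨_, hmem, ?_⟩
      simp only [Pi.neg_apply, he]
      rw [← Real.cos_neg, Real.arccos_cos (by linarith) (by linarith), neg_neg]

lemma measurable_coord (i : Fin 3) : Measurable fun x : Euc3 => x i := by fun_prop

/-- A rotation-invariant measure is invariant under randomizing the angle around the pole. -/
lemma IsSphereMeasure.map_rot (hσ : IsSphereMeasure σ) :
    MeasurePreserving (fun q : Euc3 × Circ => circ (q.1 0) q.2) (σ.prod τ) σ := by
  have := hσ.prob
  have hm : Measurable fun q : Euc3 × Circ => circ (q.1 0) q.2 :=
    continuous_circ.measurable.comp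
      (((measurable_coord 0).comp measurable_fst).prodMk measurable_snd)
  have hr : Measurable fun q : Euc3 × Circ => rot q.2 q.1 := by
    have h1 := continuous_cosA
    have h2 := continuous_sinA
    refine Continuous.measurable ?_
    simp only [rot, frame_apply]
    refine (PiLp.continuous_toLp 2 _).comp (continuous_pi fun i => ?_)
    fin_cases i <;> simp <;> fun_prop
  refine ⟨hm, Measure.ext fun B hB => ?_⟩
  have e1 : (σ.prod τ) ((fun q : Euc3 × Circ => rot q.2 q.1) ⁻¹' B) = σ B := by
    rw [Measure.prod_apply_symm (hr hB)]
    have : ∀ θ, σ ((fun x => (x, θ)) ⁻¹' ((fun q : Euc3 × Circ => rot q.2 q.1) ⁻¹' B)) = σ B :=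
      fun θ => (hσ.inv (rot θ)).measure_preimage hB.nullMeasurableSet
    simp [this]
  rw [Measure.map_apply hm hB, ← e1, Measure.prod_apply (hm hB), Measure.prod_apply (hr hB)]
  refine lintegral_congr_ae ?_
  filter_upwards [hσ.norm] with x hx
  obtain ⟨α, hα⟩ := exists_circ hx
  have := (measurePreserving_add_left τ α).measure_preimage
    ((measurable_circ (t := x 0)) hB).nullMeasurableSet
  rw [show (Prod.mk x ⁻¹' ((fun q : Euc3 × Circ => circ (q.1 0) q.2) ⁻¹' B)) = circ (x 0) ⁻¹' B
    from rfl, ← this]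
  congr 1
  ext θ
  simp only [mem_preimage]
  rw [← rot_circ, ← hα]

/-- Sets carrying no mass of the height coordinate are Lebesgue null in `(-1, 1)`. -/
lemma IsSphereMeasure.volume_eq_zero (hσ : IsSphereMeasure σ) {B : Set ℝ} (hB : MeasurableSet B)
    (h : σ {x | x 0 ∈ B} = 0) : volume (B ∩ Ioo (-1) 1) = 0 := by
  have := hσ.prob
  have h1 : ∀ s : ℚ, |(s : ℝ)| < 1 → ∀ᵐ x ∂σ,
      τ {θ | x 0 * s + Real.sqrt (1 - x 0 ^ 2) * Real.sqrt (1 - (s : ℝ) ^ 2) * cosA θ ∈ B} = 0 := by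
    intro s hs
    have hT := ((hσ.inv (frame s 0 hs.le).symm).comp hσ.map_rot)
    have hn : σ {x | x 0 ∈ B} = 0 := h
    have h2 := hT.measure_preimage ((measurable_coord 0) hB).nullMeasurableSet
    rw [show (fun x : Euc3 => x 0) ⁻¹' B = {x | x 0 ∈ B} from rfl, hn] at h2
    have h3 := Measure.ae_ae_of_ae_prod (measure_eq_zero_iff_ae_notMem.1 h2)
    filter_upwards [h3] with x hx
    rw [measure_eq_zero_iff_ae_notMem]
    filter_upwards [hx] with θ hθ
    have hc : cosA 0 = 1 := Real.Angle.cos_zero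
    have hs0 : sinA 0 = 0 := Real.Angle.sin_zero
    have : ((frame s 0 hs.le).symm (circ (x 0) θ)) 0 =
        x 0 * s + Real.sqrt (1 - x 0 ^ 2) * Real.sqrt (1 - (s : ℝ) ^ 2) * cosA θ := by
      rw [← inner_pole, ← (frame s 0 hs.le).inner_map_map, LinearIsometryEquiv.apply_symm_apply,
        frame_pole, inner_eq]
      simp [hc, hs0]; ring
    simpa [← this] using hθ
  have h2 : ∀ᵐ x ∂σ, ∀ s : ℚ, |(s : ℝ)| < 1 →
      τ {θ | x 0 * s + Real.sqrt (1 - x 0 ^ 2) * Real.sqrt (1 - (s : ℝ) ^ 2) * cosA θ ∈ B} = 0 := by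
    rw [ae_all_iff]
    intro s
    by_cases hs : |(s : ℝ)| < 1
    · filter_upwards [h1 s hs] with x hx _ using hx
    · exact Filter.Eventually.of_forall fun _ h => absurd h hs
  have h3 : ∃ x : Euc3, |x 0| < 1 ∧ ∀ s : ℚ, |(s : ℝ)| < 1 →
      τ {θ | x 0 * s + Real.sqrt (1 - x 0 ^ 2) * Real.sqrt (1 - (s : ℝ) ^ 2) * cosA θ ∈ B} = 0 := by
    by_contra! hcon
    have h4 : ∀ᵐ x ∂σ, 1 ≤ x 0 ^ 2 := by
      filter_upwards [h2] with x hx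
      by_contra hlt
      obtain ⟨s, hs, hs'⟩ := hcon x ((sq_lt_one_iff_abs_lt_one _).1 (not_le.1 hlt))
      exact hs' (hx s hs)
    have h5 := (hσ.inv (swapIso (!₂[0, 1, 0]) pole)).quasiMeasurePreserving.ae h4
    obtain ⟨x, hx0, hx1, hx⟩ := (h4.and (h5.and hσ.norm)).exists
    rw [← inner_pole, ← (swapIso (!₂[0, 1, 0]) pole).inner_map_map,
      swapIso_right (by rw [norm_pole, norm_eq_one_iff]; simp), swapIso,
      Submodule.reflection_reflection, inner_eq] at hx1
    rw [norm_eq_one_iff] at hx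
    simp only [Matrix.cons_val] at hx1
    nlinarith [sq_nonneg (x 2), sq_nonneg (x 1)]
  obtain ⟨x, hx, hx'⟩ := h3
  set u := x 0
  have hu : 0 < 1 - u ^ 2 := by
    have := (sq_lt_one_iff_abs_lt_one _).2 hx; linarith
  have h6 : ∀ s : ℚ, |(s : ℝ)| < 1 → volume (B ∩ {w | |w - u * s| ≤
      |Real.sqrt (1 - u ^ 2) * Real.sqrt (1 - (s : ℝ) ^ 2)|}) = 0 := by
    intro s hs
    have hs' : 0 < 1 - (s : ℝ) ^ 2 := by
      have := (sq_lt_one_iff_abs_lt_one _).2 hs; linarith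
    exact (τ_cosA_eq_zero_iff (mul_pos (Real.sqrt_pos.2 hu) (Real.sqrt_pos.2 hs')).ne' hB).1
      (hx' s hs)
  refine measure_mono_null (t := ⋃ s : ℚ, ⋃ _ : |(s : ℝ)| < 1, (B ∩ {w | |w - u * s| ≤
      |Real.sqrt (1 - u ^ 2) * Real.sqrt (1 - (s : ℝ) ^ 2)|})) ?_
    (measure_iUnion_null fun s => measure_iUnion_null fun hs => h6 s hs)
  rintro w ⟨hw, hw1, hw2⟩
  have hop : IsOpen {s : ℝ | |s| < 1 ∧ (w - u * s) ^ 2 < (1 - u ^ 2) * (1 - s ^ 2)} := by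
    rw [Set.ofPred_and]
    exact (isOpen_lt (by fun_prop) (by fun_prop)).inter (isOpen_lt (by fun_prop) (by fun_prop))
  have hw3 : w ^ 2 < 1 := by nlinarith
  obtain ⟨s, hs⟩ := Rat.denseRange_cast (𝕜 := ℝ) |>.exists_mem_open hop ⟨u * w, by
    refine ⟨?_, ?_⟩
    · rw [← sq_lt_one_iff_abs_lt_one]
      nlinarith [sq_nonneg w, sq_nonneg u]
    · nlinarith [mul_pos hu (sub_pos.2 hw3), sq_nonneg u]⟩
  refine mem_iUnion.2 ⟨s, mem_iUnion.2 ⟨hs.1, hw, ?_⟩⟩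
  rw [mem_ofPred_eq, ← sq_le_sq, mul_pow, Real.sq_sqrt hu.le,
    Real.sq_sqrt (one_sub_sq_nonneg hs.1.le)]
  exact hs.2.le

end SphereAvg

namespace SphereAvg

variable {σ : Measure Euc3}

/-- The second point of a two-step random walk on the sphere started at the pole. -/
def walk (t s : ℝ) (ht : |t| ≤ 1) (q : Circ × Circ) : Euc3 := frame t q.1 ht (circ s q.2)

lemma measurable_walk {t s : ℝ} (ht : |t| ≤ 1) : Measurable (walk t s ht) := by
  have h1 := continuous_cosA
  have h2 := continuous_sinA
  refine Continuous.measurable ?_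
  unfold walk
  simp only [frame_apply]
  refine (PiLp.continuous_toLp 2 _).comp (continuous_pi fun i => ?_)
  fin_cases i <;> simp <;> fun_prop

lemma norm_walk {t s : ℝ} (ht : |t| ≤ 1) (hs : |s| ≤ 1) (q : Circ × Circ) :
    ‖walk t s ht q‖ = 1 := by
  rw [walk, LinearIsometryEquiv.norm_map, norm_circ hs]

/-- A two-step random walk on the sphere has a density which depends on the height only. -/
lemma IsSphereMeasure.exists_density (hσ : IsSphereMeasure σ) {t s : ℝ} (ht : |t| < 1)
    (hs : |s| < 1) : ∃ h : ℝ → NNReal, Measurable h ∧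
      (τ.prod τ).map (walk t s ht.le) = σ.withDensity (fun x => (h (x 0) : ENNReal)) := by
  have := hσ.prob
  set w : Circ → ℝ := fun φ => t * s + (-(Real.sqrt (1 - t ^ 2) * Real.sqrt (1 - s ^ 2))) * cosA φ
    with hw
  have hwm : Measurable w := (measurable_cosA.const_mul _).const_add _
  have ht' : 0 < 1 - t ^ 2 := by
    have := (sq_lt_one_iff_abs_lt_one _).2 ht; linarith
  have hs' : 0 < 1 - s ^ 2 := by
    have := (sq_lt_one_iff_abs_lt_one _).2 hs; linarith
  set η := (τ : Measure Circ).map w with hη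
  set ρ : Measure ℝ := σ.map (fun x : Euc3 => x 0) with hρ
  have : IsProbabilityMeasure η := Measure.isProbabilityMeasure_map hwm.aemeasurable
  have : IsProbabilityMeasure ρ := Measure.isProbabilityMeasure_map
    (measurable_coord 0).aemeasurable
  have hac : η ≪ ρ := by
    refine Measure.AbsolutelyContinuous.mk fun B hB h0 => ?_
    rw [hρ, Measure.map_apply (measurable_coord 0) hB] at h0
    have h1 := hσ.volume_eq_zero hB h0
    rw [hη, Measure.map_apply hwm hB]
    refine (τ_cosA_eq_zero_iff (neg_ne_zero.2
      (mul_pos (Real.sqrt_pos.2 ht') (Real.sqrt_pos.2 hs')).ne') hB).2 ?_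
    refine measure_mono_null ?_ (measure_union_null h1
      ((Set.toFinite ({1, -1} : Set ℝ)).measure_zero volume))
    rintro v ⟨hv, hv'⟩
    rw [mem_ofPred_eq, abs_neg, ← sq_le_sq, mul_pow, Real.sq_sqrt ht'.le, Real.sq_sqrt hs'.le]
      at hv'
    have hv1 : v ^ 2 ≤ 1 := by
      by_contra hc
      nlinarith [sq_nonneg (t - s * v), sq_nonneg (s - t * v), mul_pos hs' (sub_pos.2 (not_le.1 hc)),
        sq_nonneg (v - t * s)]
    by_cases h : v ^ 2 = 1
    · right; simpa using h
    · left
      have := (sq_lt_one_iff_abs_lt_one _).1 (lt_of_le_of_ne hv1 h)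
      exact ⟨hv, abs_lt.1 this⟩
  have hd := Measure.withDensity_rnDeriv_eq η ρ hac
  refine ⟨fun u => (η.rnDeriv ρ u).toNNReal, (Measure.measurable_rnDeriv _ _).ennreal_toNNReal, ?_⟩
  set h : ℝ → NNReal := fun u => (η.rnDeriv ρ u).toNNReal with hh
  have hm : Measurable h := (Measure.measurable_rnDeriv _ _).ennreal_toNNReal
  have hd' : ρ.withDensity (fun u => (h u : ENNReal)) = η := by
    refine (withDensity_congr_ae ?_).trans hd
    filter_upwards [Measure.rnDeriv_lt_top η ρ] with u hu
    exact ENNReal.coe_toNNReal hu.ne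
  refine Measure.ext_of_lintegral _ fun F hF => ?_
  have hFc : Measurable fun q : ℝ × Circ => F (circ q.1 q.2) := hF.comp continuous_circ.measurable
  have hG : Measurable fun u => ∫⁻ θ, F (circ u θ) ∂τ := hFc.lintegral_prod_right'
  rw [lintegral_map hF (measurable_walk _),
    lintegral_prod_symm (fun q => F (walk t s ht.le q)) (hF.comp (measurable_walk _)).aemeasurable,
    lintegral_withDensity_eq_lintegral_mul _ (f := fun x : Euc3 => (h (x 0) : ENNReal))
      (hm.comp (measurable_coord 0)).coe_nnreal_ennreal hF]
  have e1 : ∀ φ, ∫⁻ θ, F (walk t s ht.le (θ, φ)) ∂τ = ∫⁻ θ, F (circ (w φ) θ) ∂τ := by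
    intro φ
    have hn : ‖frame t 0 ht.le (circ s φ)‖ = 1 := by
      rw [LinearIsometryEquiv.norm_map, norm_circ hs.le]
    obtain ⟨α, hα⟩ := exists_circ hn
    have h0 : (frame t 0 ht.le (circ s φ)) 0 = w φ := by
      simp [frame_apply, hw]; ring
    rw [h0] at hα
    rw [← lintegral_add_left_eq_self (fun θ => F (circ (w φ) θ)) α]
    refine lintegral_congr fun θ => ?_
    rw [walk, frame_eq_rot, hα, rot_circ]
  rw [lintegral_congr e1, ← lintegral_map (f := fun u => ∫⁻ θ, F (circ u θ) ∂τ) hG hwm, ← hη, ← hd',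
    lintegral_withDensity_eq_lintegral_mul _ hm.coe_nnreal_ennreal hG, hρ,
    lintegral_map (hm.coe_nnreal_ennreal.mul hG) (measurable_coord 0)]
  have hI : Measurable fun x : Euc3 => (h (x 0) : ENNReal) * F x :=
    (hm.comp (measurable_coord 0)).coe_nnreal_ennreal.mul hF
  have h3 := hσ.map_rot.lintegral_comp hI
  rw [lintegral_prod (fun q : Euc3 × Circ => (h (circ (q.1 0) q.2 0) : ENNReal) *
    F (circ (q.1 0) q.2)) (hI.comp hσ.map_rot.measurable).aemeasurable] at h3
  refine Eq.trans (lintegral_congr fun x => ?_) h3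
  simp only [Pi.mul_apply, circ_zero]
  rw [lintegral_const_mul]
  exact hF.comp measurable_circ

/-- Polynomials are dense in `L¹` of a finite measure on `[-1, 1]`. -/
lemma exists_polynomial_near (ρ : Measure ℝ) [IsProbabilityMeasure ρ] (h1 : ∀ᵐ u ∂ρ, |u| ≤ 1)
    {h : ℝ → ℝ} (hh : Integrable h ρ) {ε : ℝ} (hε : 0 < ε) :
    ∃ q : Polynomial ℝ, ∫ u, |h u - q.eval u| ∂ρ ≤ ε := by
  obtain ⟨g, -, hg, hgc, hgi⟩ := hh.exists_hasCompactSupport_integral_sub_le (half_pos hε)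
  obtain ⟨q, hq⟩ := exists_polynomial_near_of_continuousOn (-1) 1 g hgc.continuousOn (ε / 2)
    (half_pos hε)
  have h2 : ∀ᵐ u ∂ρ, |g u - q.eval u| ≤ ε / 2 := by
    filter_upwards [h1] with u hu
    rw [abs_sub_comm]
    exact (hq u (abs_le.1 hu)).le
  have hi2 : Integrable (fun u => |g u - q.eval u|) ρ := by
    refine Integrable.mono' (integrable_const (ε / 2)) ?_ (by simpa using h2)
    exact ((hgc.sub q.continuous).abs).aestronglyMeasurable
  refine ⟨q, ?_⟩
  calc ∫ u, |h u - q.eval u| ∂ρ ≤ ∫ u, (‖h u - g u‖ + |g u - q.eval u|) ∂ρ := by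
        refine integral_mono_of_nonneg (Filter.Eventually.of_forall fun _ => abs_nonneg _)
          ((hh.sub hgi).norm.add hi2) (Filter.Eventually.of_forall fun u => ?_)
        exact abs_sub_le _ _ _
    _ = ∫ u, ‖h u - g u‖ ∂ρ + ∫ u, |g u - q.eval u| ∂ρ := integral_add (hh.sub hgi).norm hi2
    _ ≤ ε / 2 + ∫ _, ε / 2 ∂ρ := add_le_add hg (integral_mono_ae hi2 (integrable_const _) h2)
    _ = ε := by simp

/-- Two averaging operations compose to an operator which is approximated in norm by polynomial
zonal kernels. -/
lemma IsSphereMeasure.exists_polynomial_approx (hσ : IsSphereMeasure σ) {t s : ℝ} (ht : |t| < 1)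
    (hs : |s| < 1) {ε : ℝ} (hε : 0 < ε) : ∃ q : Polynomial ℝ, ∀ f : Euc3 → ℝ, Integrable f σ →
      ∀ B : ℝ, (∀ p : Euc3, ‖p‖ = 1 → |∫ x, f x * q.eval ⟪x, p⟫ ∂σ| ≤ B) →
        ∫ y, |avg t (avg s f) y| ∂σ ≤ ε * ∫ x, |f x| ∂σ + B := by
  have := hσ.prob
  obtain ⟨h, hm, hκ⟩ := hσ.exists_density ht hs
  set κ := (τ.prod τ).map (walk t s ht.le) with hκ'
  have hwm := measurable_walk (s := s) ht.le
  have : IsProbabilityMeasure κ := Measure.isProbabilityMeasure_map hwm.aemeasurable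
  have hm0 : Measurable fun x : Euc3 => h (x 0) := hm.comp (measurable_coord 0)
  have h_int : Integrable (fun x : Euc3 => (h (x 0) : ℝ)) σ := by
    refine ⟨hm0.coe_nnreal_real.aestronglyMeasurable, ?_⟩
    have := measure_univ (μ := κ)
    rw [hκ, withDensity_apply _ MeasurableSet.univ, Measure.restrict_univ] at this
    simp [HasFiniteIntegral, enorm_eq_nnnorm, this]
  set ρ : Measure ℝ := σ.map (fun x : Euc3 => x 0) with hρ
  have : IsProbabilityMeasure ρ := Measure.isProbabilityMeasure_map
    (measurable_coord 0).aemeasurable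
  have hρ1 : ∀ᵐ u ∂ρ, |u| ≤ 1 := by
    rw [hρ, ae_map_iff (measurable_coord 0).aemeasurable
      (measurableSet_le continuous_abs.measurable measurable_const)]
    filter_upwards [hσ.norm] with x hx using abs_le_one_of_norm hx
  have h_intρ : Integrable (fun u => (h u : ℝ)) ρ := by
    rw [hρ, integrable_map_measure hm.coe_nnreal_real.aestronglyMeasurable
      (measurable_coord 0).aemeasurable]
    exact h_int
  obtain ⟨q, hq⟩ := exists_polynomial_near ρ hρ1 h_intρ hε
  have hqm : Measurable fun u => |(h u : ℝ) - q.eval u| :=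
    (hm.coe_nnreal_real.sub q.continuous.measurable).abs
  rw [hρ, integral_map (measurable_coord 0).aemeasurable hqm.aestronglyMeasurable] at hq
  refine ⟨q, fun f hf B hB => ?_⟩
  have hκn : ∀ᵐ z ∂κ, ‖z‖ = 1 := by
    rw [hκ', ae_map_iff hwm.aemeasurable (measurableSet_eq_fun measurable_norm measurable_const)]
    exact Filter.Eventually.of_forall (norm_walk ht.le hs.le)
  have i1 := (hσ.map_act_prod (μ := κ) measurable_id hκn).integrable_comp_of_integrable hf
  have i2 := (hσ.map_act_prod (μ := τ.prod τ) hwm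
    (Filter.Eventually.of_forall (norm_walk ht.le hs.le))).integrable_comp_of_integrable hf
  have i3 := (hσ.map_act_prod (μ := σ) measurable_id hσ.norm).integrable_comp_of_integrable hf
  -- bounded polynomial factor on the sphere
  have hq0 : Continuous fun x : Euc3 => q.eval (x 0) := by fun_prop
  obtain ⟨D, hD⟩ := (isCompact_sphere (0 : Euc3) 1).exists_bound_of_continuousOn hq0.continuousOn
  have hD' : ∀ᵐ x ∂σ, ‖q.eval (x 0)‖ ≤ D := by
    filter_upwards [hσ.norm] with x hx using hD x (by simpa using hx)
  have hdiff : Integrable (fun x : Euc3 => |(h (x 0) : ℝ) - q.eval (x 0)|) σ :=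
    (h_int.sub (Integrable.mono' (integrable_const D) hq0.aestronglyMeasurable hD')).abs
  -- integrability of the error term on the product space
  have hprod : Integrable (fun p : Iso3 × Euc3 => |f (act p.1 p.2)| *
      |(h (p.2 0) : ℝ) - q.eval (p.2 0)|) (haarIso.prod σ) := by
    have hme : AEStronglyMeasurable (fun p : Iso3 × Euc3 => |f (act p.1 p.2)| *
        |(h (p.2 0) : ℝ) - q.eval (p.2 0)|) (haarIso.prod σ) := (i3.aestronglyMeasurable.norm.mul
      hdiff.aestronglyMeasurable.comp_snd)
    refine (integrable_prod_iff' hme).2 ⟨?_, ?_⟩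
    · filter_upwards [hσ.norm] with x hx
      exact ((hσ.map_act hx).integrable_comp_of_integrable hf).norm.mul_const _
    · refine (hdiff.const_mul (∫ x, |f x| ∂σ)).congr ?_
      filter_upwards [hσ.norm] with x hx
      simp only [norm_mul, Real.norm_eq_abs, abs_abs]
      rw [integral_mul_const]
      congr 1
      exact ((hσ.map_act hx).integral_comp_ae hf.abs.aestronglyMeasurable).symm
  have hA := hσ.integrable_avg ht.le (hσ.integrable_avg hs.le hf)
  have key : ∀ᵐ U ∂haarIso, |avg t (avg s f) (act U pole)| ≤
      ∫ x, |f (act U x)| * |(h (x 0) : ℝ) - q.eval (x 0)| ∂σ + B := by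
    filter_upwards [i1.prod_right_ae, i2.prod_right_ae, i3.prod_right_ae, hprod.prod_right_ae]
      with U h1 h2 h3 h4
    simp only [id, Function.comp_def] at h1 h2 h3 h4
    have e1 : avg t (avg s f) (act U pole) = ∫ x, (h (x 0) : ℝ) * f (act U x) ∂σ := by
      have : ∀ θ, avg s f (act U (circ t θ)) = ∫ φ, f (act U (walk t s ht.le (θ, φ))) ∂τ := by
        intro θ
        rw [← frame_pole t θ ht.le]
        exact avg_eq ((frame t θ ht.le).trans (act U)) s f
      rw [avg_eq]
      simp_rw [this]
      rw [← integral_prod _ h2, ← integral_map (f := fun z => f (act U z)) hwm.aemeasurable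
        h1.aestronglyMeasurable, ← hκ', hκ, integral_withDensity_eq_integral_smul hm0]
      rfl
    have e2 : ∫ x, f (act U x) * q.eval (x 0) ∂σ = ∫ x, f x * q.eval ⟪x, act U pole⟫ ∂σ := by
      have hc : Continuous fun x : Euc3 => q.eval ⟪x, act U pole⟫ := by fun_prop
      rw [← (hσ.inv (act U)).integral_comp_ae (f := fun x => f x * q.eval ⟪x, act U pole⟫)
        (hf.aestronglyMeasurable.mul hc.aestronglyMeasurable)]
      simp only [LinearIsometryEquiv.inner_map_map, inner_pole]
    have h5 : Integrable (fun x => f (act U x) * q.eval (x 0)) σ :=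
      h3.mul_bdd (c := D) hq0.aestronglyMeasurable hD'
    have h6 : Integrable (fun x => f (act U x) * ((h (x 0) : ℝ) - q.eval (x 0))) σ := by
      refine (integrable_norm_iff (h3.aestronglyMeasurable.mul
        (hm0.coe_nnreal_real.sub hq0.measurable).aestronglyMeasurable)).1 ?_
      simpa only [Pi.mul_apply, Pi.sub_apply, norm_mul, Real.norm_eq_abs] using h4
    have e3 : ∫ x, (h (x 0) : ℝ) * f (act U x) ∂σ =
        ∫ x, f (act U x) * ((h (x 0) : ℝ) - q.eval (x 0)) ∂σ +
          ∫ x, f (act U x) * q.eval (x 0) ∂σ := by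
      rw [← integral_add h6 h5]
      congr 1
      funext x
      ring
    rw [e1, e3, e2]
    refine (abs_add_le _ _).trans (add_le_add ?_ (hB _ (by rw [LinearIsometryEquiv.norm_map,
      norm_pole])))
    refine (abs_integral_le_integral_abs).trans (le_of_eq ?_)
    simp only [abs_mul]
  calc ∫ y, |avg t (avg s f) y| ∂σ = ∫ U, |avg t (avg s f) (act U pole)| ∂haarIso :=
        ((hσ.map_act norm_pole).integral_comp_ae hA.abs.aestronglyMeasurable).symm
    _ ≤ ∫ U, (∫ x, |f (act U x)| * |(h (x 0) : ℝ) - q.eval (x 0)| ∂σ + B) ∂haarIso :=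
        integral_mono_of_nonneg (Filter.Eventually.of_forall fun _ => abs_nonneg _)
          (hprod.integral_prod_left.add (integrable_const _)) key
    _ = ∫ x, ∫ U, |f (act U x)| * |(h (x 0) : ℝ) - q.eval (x 0)| ∂haarIso ∂σ + B := by
        rw [integral_add hprod.integral_prod_left (integrable_const _)]
        simp only [integral_const, probReal_univ, one_smul]
        rw [integral_integral_swap hprod]
    _ = ∫ x, (∫ y, |f y| ∂σ) * |(h (x 0) : ℝ) - q.eval (x 0)| ∂σ + B := by
        congr 1
        refine integral_congr_ae ?_
        filter_upwards [hσ.norm] with x hx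
        rw [integral_mul_const]
        congr 1
        exact (hσ.map_act hx).integral_comp_ae hf.abs.aestronglyMeasurable
    _ ≤ ε * ∫ x, |f x| ∂σ + B := by
        rw [integral_const_mul, mul_comm]
        gcongr

end SphereAvg

namespace SphereAvg

open Finset Polynomial

variable {σ : Measure Euc3}

lemma integral_cosA_pow_succ_succ (n : ℕ) :
    ∫ θ, cosA θ ^ (n + 2) ∂τ = (n + 1) / (n + 2) * ∫ θ, cosA θ ^ n ∂τ := by
  simp only [integral_τ, cosA_coe, integral_cos_pow]
  simp
  ring

lemma integral_cosA_pow_odd (j : ℕ) : ∫ θ, cosA θ ^ (2 * j + 1) ∂τ = 0 := by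
  induction j with
  | zero => simp [integral_τ, cosA_coe]
  | succ j ih =>
    rw [show 2 * (j + 1) + 1 = 2 * j + 1 + 2 by ring, integral_cosA_pow_succ_succ, ih, mul_zero]

lemma integral_cosA_pow_even (j : ℕ) :
    ∫ θ, cosA θ ^ (2 * j) ∂τ = (j.centralBinom : ℝ) / 4 ^ j := by
  induction j with
  | zero => simp
  | succ j ih =>
    rw [show 2 * (j + 1) = 2 * j + 2 by ring, integral_cosA_pow_succ_succ, ih]
    have h : ((j : ℝ) + 1) * (j + 1).centralBinom = 2 * (2 * j + 1) * j.centralBinom := by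
      exact_mod_cast Nat.succ_mul_centralBinom_succ j
    have h1 : (j : ℝ) + 1 ≠ 0 := by positivity
    have h2 : ((2 * j : ℕ) : ℝ) + 2 ≠ 0 := by positivity
    push_cast at h2 ⊢
    field_simp
    rw [pow_succ]
    linear_combination (-2 * 4 ^ j : ℝ) * h

lemma sum_range_even {F : ℕ → ℝ} (hF : ∀ j, F (2 * j + 1) = 0) (m : ℕ) :
    ∑ i ∈ range (2 * m + 1), F i = ∑ j ∈ range (m + 1), F (2 * j) := by
  induction m with
  | zero => simp
  | succ m ih =>
    rw [show 2 * (m + 1) + 1 = 2 * m + 1 + 1 + 1 by ring, sum_range_succ, sum_range_succ, ih, hF,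
      add_zero, sum_range_succ _ (m + 1)]
    rfl

/-- The image of an even power under averaging, as a polynomial in the squared height. -/
def powAvg (t : ℝ) (m : ℕ) : ℝ[X] :=
  ∑ j ∈ range (m + 1), C (((2 * m).choose (2 * j) : ℝ) * ((j.centralBinom : ℝ) / 4 ^ j) *
    (t ^ (2 * (m - j)) * (1 - t ^ 2) ^ j)) * (X ^ (m - j) * (1 - X) ^ j)

/-- The leading coefficient of `powAvg t m`. -/
def eigen (t : ℝ) (m : ℕ) : ℝ :=
  ∑ j ∈ range (m + 1), ((2 * m).choose (2 * j) : ℝ) * ((j.centralBinom : ℝ) / 4 ^ j) *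
    (t ^ (2 * (m - j)) * (1 - t ^ 2) ^ j) * (-1) ^ j

lemma natDegree_aux {m j : ℕ} (hj : j ≤ m) :
    (X ^ (m - j) * (1 - X) ^ j : ℝ[X]).natDegree ≤ m := by
  refine natDegree_mul_le.trans ?_
  have h1 : ((1 - X : ℝ[X]) ^ j).natDegree ≤ j * 1 :=
    natDegree_pow_le_of_le j (by compute_degree)
  rw [natDegree_X_pow]
  omega

lemma natDegree_powAvg_le (t : ℝ) (m : ℕ) : (powAvg t m).natDegree ≤ m := by
  refine natDegree_sum_le_of_forall_le _ _ fun j hj => ?_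
  refine (natDegree_C_mul_le _ _).trans (natDegree_aux ?_)
  have := mem_range.1 hj
  omega

lemma coeff_powAvg (t : ℝ) (m : ℕ) : (powAvg t m).coeff m = eigen t m := by
  rw [powAvg, finsetSum_coeff, eigen]
  refine sum_congr rfl fun j hj => ?_
  have hj' : j ≤ m := by have := mem_range.1 hj; omega
  rw [coeff_C_mul]
  congr 1
  have h1 : ((1 - X : ℝ[X]) ^ j).coeff (1 * j) = (-1) ^ j := by
    rw [mul_comm, coeff_pow_of_natDegree_le (by compute_degree)]
    simp [coeff_one]
  have := coeff_X_pow_mul ((1 - X : ℝ[X]) ^ j) (m - j) j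
  rw [Nat.add_sub_cancel' hj'] at this
  rw [this, ← h1, one_mul]

lemma eval_powAvg {t s : ℝ} (ht : |t| ≤ 1) (hs : |s| ≤ 1) (m : ℕ) :
    ∫ θ, (t * s + Real.sqrt (1 - t ^ 2) * Real.sqrt (1 - s ^ 2) * cosA θ) ^ (2 * m) ∂τ =
      (powAvg t m).eval (s ^ 2) := by
  have hc := continuous_cosA
  simp only [add_comm (t * s), add_pow]
  rw [integral_finsetSum _ fun i _ => (Continuous.integrable_of_hasCompactSupport (by fun_prop)
    (HasCompactSupport.of_compactSpace _))]
  have h : ∀ i, ∫ θ, (Real.sqrt (1 - t ^ 2) * Real.sqrt (1 - s ^ 2) * cosA θ) ^ i *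
      (t * s) ^ (2 * m - i) * ((2 * m).choose i : ℝ) ∂τ =
      (Real.sqrt (1 - t ^ 2) * Real.sqrt (1 - s ^ 2)) ^ i * (t * s) ^ (2 * m - i) *
        ((2 * m).choose i : ℝ) * ∫ θ, cosA θ ^ i ∂τ := by
    intro i
    rw [← integral_const_mul]
    congr 1
    funext θ
    ring
  simp only [h]
  rw [sum_range_even (fun j => by rw [integral_cosA_pow_odd, mul_zero]), powAvg, eval_finsetSum]
  refine sum_congr rfl fun j hj => ?_
  have hj' : j ≤ m := by have := mem_range.1 hj; omega
  rw [integral_cosA_pow_even, mul_pow, pow_mul (Real.sqrt (1 - t ^ 2)),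
    pow_mul (Real.sqrt (1 - s ^ 2)), Real.sq_sqrt (one_sub_sq_nonneg ht),
    Real.sq_sqrt (one_sub_sq_nonneg hs), ← Nat.mul_sub]
  simp only [eval_mul, eval_C, eval_pow, eval_X, eval_sub, eval_one]
  ring

lemma avg_inner_pow {t : ℝ} (ht : |t| ≤ 1) {x p : Euc3} (hx : ‖x‖ = 1) (hp : ‖p‖ = 1) (m : ℕ) :
    avg t (fun y => ⟪y, p⟫ ^ (2 * m)) x = (powAvg t m).eval (⟪x, p⟫ ^ 2) := by
  obtain ⟨V, hV, -⟩ := exists_iso_eq (x := pole) (y := x) (by rw [norm_pole, hx])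
  have hn : ‖(act V).symm p‖ = 1 := by rw [LinearIsometryEquiv.norm_map, hp]
  obtain ⟨α, hα⟩ := exists_circ hn
  have hs : ((act V).symm p) 0 = ⟪x, p⟫ := by
    rw [← inner_pole, ← (act V).inner_map_map, LinearIsometryEquiv.apply_symm_apply, hV,
      real_inner_comm]
  rw [← hV, avg_eq, hV, ← eval_powAvg ht (hs ▸ abs_le_one_of_norm hn),
    ← integral_add_right_eq_self _ α]
  congr 1
  funext θ
  congr 1
  rw [← (act V).symm.inner_map_map, LinearIsometryEquiv.symm_apply_apply, hα, hs, inner_eq]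
  simp only [circ_zero, circ_one, circ_two, cosA_add, sinA_add]
  linear_combination (Real.sqrt (1 - t ^ 2) * Real.sqrt (1 - ⟪x, p⟫ ^ 2) * cosA θ) *
    cosA_sq_add_sinA_sq α

/-- Even moments of a function in the direction `p`. -/
def moment (σ : Measure Euc3) (m : ℕ) (f : Euc3 → ℝ) (p : Euc3) : ℝ :=
  ∫ x, f x * ⟪x, p⟫ ^ (2 * m) ∂σ

lemma abs_inner_le_one {x p : Euc3} (hx : ‖x‖ = 1) (hp : ‖p‖ = 1) : |⟪x, p⟫| ≤ 1 := by
  simpa [hx, hp] using abs_real_inner_le_norm x p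

lemma IsSphereMeasure.integrable_mul_inner_pow (hσ : IsSphereMeasure σ) {f : Euc3 → ℝ}
    (hf : Integrable f σ) {p : Euc3} (hp : ‖p‖ = 1) (k : ℕ) :
    Integrable (fun x => f x * ⟪x, p⟫ ^ k) σ := by
  refine hf.mul_bdd (c := 1) (by fun_prop) ?_
  filter_upwards [hσ.norm] with x hx
  rw [norm_pow]
  exact pow_le_one₀ (norm_nonneg _) (abs_inner_le_one hx hp)

lemma IsSphereMeasure.abs_moment_le (hσ : IsSphereMeasure σ) {f : Euc3 → ℝ}
    (hf : Integrable f σ) {p : Euc3} (hp : ‖p‖ = 1) (m : ℕ) :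
    |moment σ m f p| ≤ ∫ x, |f x| ∂σ := by
  refine abs_integral_le_integral_abs.trans (integral_mono_ae
    (hσ.integrable_mul_inner_pow hf hp _).abs hf.abs ?_)
  filter_upwards [hσ.norm] with x hx
  rw [abs_mul, abs_pow]
  exact mul_le_of_le_one_right (abs_nonneg _) (pow_le_one₀ (abs_nonneg _) (abs_inner_le_one hx hp))

lemma IsSphereMeasure.integral_mul_eval (hσ : IsSphereMeasure σ) {f : Euc3 → ℝ}
    (hf : Integrable f σ) {p : Euc3} (hp : ‖p‖ = 1) (P : ℝ[X]) {n : ℕ} (hP : P.natDegree < n) :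
    ∫ x, f x * P.eval (⟪x, p⟫ ^ 2) ∂σ = ∑ j ∈ range n, P.coeff j * moment σ j f p := by
  simp only [eval_eq_sum_range' hP, mul_sum, moment, ← integral_const_mul]
  rw [← integral_finsetSum]
  · congr 1
    funext x
    refine sum_congr rfl fun j _ => ?_
    rw [← pow_mul]; ring
  · intro j _
    exact (hσ.integrable_mul_inner_pow hf hp (2 * j)).const_mul _

lemma IsSphereMeasure.moment_avg (hσ : IsSphereMeasure σ) {t : ℝ} (ht : |t| ≤ 1) {f : Euc3 → ℝ}
    (hf : Integrable f σ) {p : Euc3} (hp : ‖p‖ = 1) (m : ℕ) :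
    moment σ m (avg t f) p = ∑ j ∈ range (m + 1), (powAvg t m).coeff j * moment σ j f p := by
  rw [← hσ.integral_mul_eval hf hp _ (Nat.lt_succ_of_le (natDegree_powAvg_le t m)), moment,
    hσ.integral_avg_mul ht hf (g := fun x => ⟪x, p⟫ ^ (2 * m)) (by fun_prop)]
  refine integral_congr_ae ?_
  filter_upwards [hσ.norm] with x hx
  rw [avg_inner_pow ht hx hp]

end SphereAvg

namespace SphereAvg

open Finset

/-- The real numbers which are rational with odd denominator. -/
def oddDen : Subring ℝ where
  carrier := {q | ∃ (k : ℕ) (n : ℤ), q * (2 * k + 1) = n}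
  zero_mem' := ⟨0, 0, by simp⟩
  one_mem' := ⟨0, 1, by simp⟩
  add_mem' := by
    rintro p q ⟨k, n, h⟩ ⟨l, n', h'⟩
    refine ⟨2 * k * l + k + l, n * (2 * l + 1) + n' * (2 * k + 1), ?_⟩
    push_cast
    rw [← h, ← h']
    ring
  mul_mem' := by
    rintro p q ⟨k, n, h⟩ ⟨l, n', h'⟩
    refine ⟨2 * k * l + k + l, n * n', ?_⟩
    push_cast
    rw [← h, ← h']
    ring
  neg_mem' := by
    rintro p ⟨k, n, h⟩
    refine ⟨k, -n, ?_⟩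
    push_cast
    rw [← h]
    ring

lemma half_notMem_oddDen : (1 / 2 : ℝ) ∉ oddDen := by
  rintro ⟨k, n, h⟩
  have h' : ((2 * k + 1 : ℤ) : ℝ) = ((2 * n : ℤ) : ℝ) := by
    push_cast
    linear_combination 2 * h
  have := Int.cast_injective h'
  omega

lemma div_mem_oddDen (n : ℤ) (k : ℕ) : (n : ℝ) / (2 * k + 1) ∈ oddDen :=
  ⟨k, n, div_mul_cancel₀ _ (by positivity)⟩

/-- The reciprocal of the mean value of `cos ^ (2 * j)`. -/
def wallis (j : ℕ) : ℝ := 4 ^ j / j.centralBinom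

lemma wallis_zero : wallis 0 = 1 := by simp [wallis]

lemma wallis_succ (j : ℕ) : wallis (j + 1) = wallis j * (2 * (j + 1)) * ((1 : ℤ) / (2 * j + 1)) := by
  have h : ((j : ℝ) + 1) * (j + 1).centralBinom = 2 * (2 * j + 1) * j.centralBinom := by
    exact_mod_cast Nat.succ_mul_centralBinom_succ j
  have h1 : ((j + 1).centralBinom : ℝ) ≠ 0 := by exact_mod_cast Nat.centralBinom_ne_zero _
  have h2 : (j.centralBinom : ℝ) ≠ 0 := by exact_mod_cast Nat.centralBinom_ne_zero _
  have h3 : (2 * j + 1 : ℝ) ≠ 0 := by positivity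
  rw [wallis, wallis, div_mul_eq_mul_div, Int.cast_one, mul_one_div, div_div,
    div_eq_div_iff h1 (mul_ne_zero h2 h3)]
  rw [pow_succ]
  linear_combination (-2 * 4 ^ j : ℝ) * h

lemma wallis_mem (j : ℕ) : wallis j ∈ oddDen := by
  induction j with
  | zero => rw [wallis_zero]; exact one_mem _
  | succ j ih =>
    rw [wallis_succ]
    exact mul_mem (mul_mem ih (mul_mem (ofNat_mem _ 2) (add_mem (natCast_mem _ j) (one_mem _))))
      (div_mem_oddDen 1 j)

lemma wallis_div_mem (j : ℕ) : wallis (j + 3) / 16 ∈ oddDen := by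
  induction j with
  | zero =>
    rw [wallis_succ, wallis_succ, wallis_succ, wallis_zero]
    convert div_mem_oddDen 1 2 using 1
    norm_num
  | succ j ih =>
    rw [show j + 1 + 3 = (j + 3) + 1 by ring, wallis_succ]
    have := mul_mem (mul_mem ih (mul_mem (ofNat_mem _ 2)
      (add_mem (natCast_mem _ (j + 3)) (one_mem _)))) (div_mem_oddDen 1 (j + 3))
    convert this using 1
    ring

lemma choose_identity (i j : ℕ) :
    (((2 * (i + j)).choose (2 * j) * j.centralBinom * i.centralBinom : ℕ) : ℝ) =
      ((i + j).centralBinom * (i + j).choose i ^ 2 : ℕ) := by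
  rw [Nat.centralBinom, Nat.centralBinom, Nat.centralBinom,
    show 2 * (i + j) = 2 * j + 2 * i by ring]
  push_cast
  rw [Nat.cast_add_choose, Nat.cast_add_choose, show 2 * j + 2 * i = (i + j) + (i + j) by ring,
    Nat.cast_add_choose, two_mul j, two_mul i, Nat.cast_add_choose, Nat.cast_add_choose]
  have := Nat.factorial_ne_zero
  field_simp

/-- The eigenvalue, up to a factor independent of the height, as a polynomial in `r = t ^ 2`. -/
def eigenSum (r : ℝ) (m : ℕ) : ℝ :=
  ∑ i ∈ range (m + 1), (m.choose i : ℝ) ^ 2 * wallis i * (-1) ^ i * r ^ i * (1 - r) ^ (m - i)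

lemma eigen_eq (t : ℝ) (m : ℕ) : wallis m * eigen t m = (-1) ^ m * eigenSum (t ^ 2) m := by
  rw [eigen, ← sum_range_reflect, eigenSum, mul_sum, mul_sum]
  refine sum_congr rfl fun i hi => ?_
  obtain ⟨j, rfl⟩ := Nat.exists_eq_add_of_le (Nat.lt_succ_iff.1 (mem_range.1 hi))
  rw [show i + j + 1 - 1 - i = j by omega, show i + j - j = i by omega,
    show i + j - i = j by omega]
  have h := choose_identity i j
  push_cast at h
  have h1 : ((i + j).centralBinom : ℝ) ≠ 0 := by exact_mod_cast Nat.centralBinom_ne_zero _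
  have h2 : (i.centralBinom : ℝ) ≠ 0 := by exact_mod_cast Nat.centralBinom_ne_zero _
  have h3 : ((-1 : ℝ) ^ i) ^ 2 = 1 := by rw [← pow_mul, mul_comm, pow_mul]; norm_num
  rw [wallis, wallis, pow_mul, pow_add (-1 : ℝ), pow_add (4 : ℝ)]
  field_simp
  rw [h3]
  linear_combination (t ^ (i * 2) * (1 - t ^ 2) ^ j) * h

lemma eigen_mem {t : ℝ} (ht : t ∈ oddDen) (ht' : (1 - t ^ 2) / 4 ∈ oddDen) (m : ℕ) :
    eigen t m ∈ oddDen := by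
  refine sum_mem fun j _ => ?_
  have : ((2 * m).choose (2 * j) : ℝ) * ((j.centralBinom : ℝ) / 4 ^ j) *
      (t ^ (2 * (m - j)) * (1 - t ^ 2) ^ j) * (-1) ^ j = ((2 * m).choose (2 * j) : ℝ) *
      (j.centralBinom : ℝ) * t ^ (2 * (m - j)) * ((1 - t ^ 2) / 4) ^ j * (-1) ^ j := by
    rw [div_pow]; ring
  rw [this]
  exact mul_mem (mul_mem (mul_mem (mul_mem (natCast_mem _ _) (natCast_mem _ _)) (pow_mem ht _))
    (pow_mem ht' _)) (pow_mem (neg_mem (one_mem _)) _)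

lemma exists_eigenSum_eq {a u : ℝ} (ha : a ∈ oddDen) (hu : u ∈ oddDen) (m : ℕ) :
    ∃ w ∈ oddDen, eigenSum (a * u) m = 1 + a * w := by
  have hr := mul_mem ha hu
  have h1r := sub_mem (one_mem oddDen) hr
  have h0 : ∀ n : ℕ, ∃ w ∈ oddDen, (1 - a * u) ^ n = 1 + a * w := by
    intro n
    induction n with
    | zero => exact ⟨0, zero_mem _, by simp⟩
    | succ n ih =>
      obtain ⟨w, hw, h⟩ := ih
      exact ⟨w - u - a * u * w, sub_mem (sub_mem hw hu) (mul_mem hr hw), by rw [pow_succ, h]; ring⟩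
  obtain ⟨w, hw, h⟩ := h0 m
  refine ⟨(∑ i ∈ range m, (m.choose (i + 1) : ℝ) ^ 2 * wallis (i + 1) * (-1) ^ (i + 1) *
    ((a * u) ^ i * u) * (1 - a * u) ^ (m - (i + 1))) + w, ?_, ?_⟩
  · refine add_mem (sum_mem fun i _ => ?_) hw
    exact mul_mem (mul_mem (mul_mem (mul_mem (pow_mem (natCast_mem _ _) _) (wallis_mem _))
      (pow_mem (neg_mem (one_mem _)) _)) (mul_mem (pow_mem hr _) hu)) (pow_mem h1r _)
  · rw [eigenSum, sum_range_succ', mul_add, mul_sum]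
    simp only [Nat.choose_zero_right, Nat.cast_one, one_pow, wallis_zero, pow_zero, mul_one,
      Nat.sub_zero, h]
    rw [add_comm, one_mul, add_assoc, add_comm (a * w)]
    congr 2
    exact sum_congr rfl fun i _ => by ring

/-- The eigenvalues of the convolution operator on even spherical harmonics. -/
def eigenPhi (m : ℕ) : ℝ :=
  eigen 1 m + 3 * eigen (4 / 5) m + eigen (3 / 5) m + 4 * eigen (2 / 5) m + 2 * eigen (1 / 5) m +
    eigen 0 m

lemma eigenPhi_ne_zero {m : ℕ} (hm : m ≠ 1) : eigenPhi m ≠ 0 := by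
  rcases Nat.lt_or_ge m 3 with h3 | h3
  · interval_cases m
    · simp [eigenPhi, eigen]; norm_num
    · exact absurd rfl hm
    · simp [eigenPhi, eigen, sum_range_succ, Nat.centralBinom, Nat.choose]; norm_num
  intro h0
  have hd := div_mem_oddDen
  have h25 : (1 / 25 : ℝ) ∈ oddDen := by convert hd 1 12 using 1; norm_num
  have m1 : eigen 1 m ∈ oddDen := eigen_mem (one_mem _) (by norm_num) m
  have m3 : eigen (3 / 5) m ∈ oddDen := by
    refine eigen_mem ?_ ?_ m
    · convert hd 3 2 using 1; norm_num
    · convert hd 4 12 using 1; norm_num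
  have m5 : eigen (1 / 5) m ∈ oddDen := by
    refine eigen_mem ?_ ?_ m
    · convert hd 1 2 using 1; norm_num
    · convert hd 6 12 using 1; norm_num
  obtain ⟨w2, hw2, e2⟩ := exists_eigenSum_eq (show (16 : ℝ) ∈ oddDen from ofNat_mem oddDen 16) h25 m
  obtain ⟨w4, hw4, e4⟩ := exists_eigenSum_eq (show (4 : ℝ) ∈ oddDen from ofNat_mem oddDen 4) h25 m
  obtain ⟨w6, hw6, e6⟩ := exists_eigenSum_eq (zero_mem oddDen) h25 m
  have f2 := eigen_eq (4 / 5) m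
  have f4 := eigen_eq (2 / 5) m
  have f6 := eigen_eq 0 m
  rw [show ((4 : ℝ) / 5) ^ 2 = 16 * (1 / 25) by norm_num, e2] at f2
  rw [show ((2 : ℝ) / 5) ^ 2 = 4 * (1 / 25) by norm_num, e4] at f4
  rw [show (0 : ℝ) ^ 2 = 0 * (1 / 25) by norm_num, e6] at f6
  obtain ⟨n, rfl⟩ := Nat.exists_eq_add_of_le' h3
  have hs := wallis_div_mem n
  set d := wallis (n + 3)
  set e := eigen 1 (n + 3) + eigen (3 / 5) (n + 3) + 2 * eigen (1 / 5) (n + 3)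
  have he : e ∈ oddDen := add_mem (add_mem m1 m3) (mul_mem (ofNat_mem _ 2) m5)
  have h1 : ((-1 : ℝ) ^ (n + 3)) ^ 2 = 1 := by rw [← pow_mul, mul_comm, pow_mul]; norm_num
  have key : (1 / 2 : ℝ) = -((-1) ^ (n + 3) * (d / 16) * e) - (3 * w2 + w4) := by
    have h2 : d * eigenPhi (n + 3) = 0 := by rw [h0, mul_zero]
    have h3 : d * eigenPhi (n + 3) = d * e + 3 * (d * eigen (4 / 5) (n + 3)) +
      4 * (d * eigen (2 / 5) (n + 3)) + d * eigen 0 (n + 3) := by simp only [eigenPhi, e]; ring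
    rw [h3, f2, f4, f6] at h2
    linear_combination (1 / 16 * (-1 : ℝ) ^ (n + 3)) * h2 - (8 + 48 * w2 + 16 * w4) / 16 * h1
  refine half_notMem_oddDen ?_
  rw [key]
  exact sub_mem (neg_mem (mul_mem (mul_mem (pow_mem (neg_mem (one_mem _)) _) hs) he))
    (add_mem (mul_mem (ofNat_mem _ 3) hw2) hw4)

end SphereAvg

namespace SphereAvg

open Finset Polynomial

variable {σ : Measure Euc3}

/-- The heights below `1` occurring in the convolution operator. -/
def height : Fin 5 → ℝ := ![4 / 5, 3 / 5, 2 / 5, 1 / 5, 0]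

/-- The weights of the heights below `1` in the convolution operator. -/
def weight : Fin 5 → ℝ := ![3, 1, 4, 2, 1]

lemma abs_height_lt (i : Fin 5) : |height i| < 1 := by
  fin_cases i <;> simp [height, abs_of_pos] <;> norm_num

lemma weight_pos (i : Fin 5) : 0 < weight i := by
  fin_cases i <;> simp [weight]

lemma sum_weight : ∑ i, weight i = 11 := by
  simp [Fin.sum_univ_succ, weight]
  norm_num

/-- The convolution operator, in terms of `avg`. -/
def phi (f : Euc3 → ℝ) : Euc3 → ℝ := fun y => f y + ∑ i, weight i * avg (height i) f y

lemma IsSphereMeasure.integrable_sum_avg (hσ : IsSphereMeasure σ) {f : Euc3 → ℝ}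
    (hf : Integrable f σ) : Integrable (fun y => ∑ i, weight i * avg (height i) f y) σ :=
  integrable_finsetSum _ fun i _ => (hσ.integrable_avg (abs_height_lt i).le hf).const_mul _

lemma IsSphereMeasure.integrable_phi (hσ : IsSphereMeasure σ) {f : Euc3 → ℝ}
    (hf : Integrable f σ) : Integrable (phi f) σ :=
  hf.add (hσ.integrable_sum_avg hf)

lemma IsSphereMeasure.integral_abs_phi_le (hσ : IsSphereMeasure σ) {f : Euc3 → ℝ}
    (hf : Integrable f σ) : ∫ x, |phi f x| ∂σ ≤ 12 * ∫ x, |f x| ∂σ := by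
  have ha i := hσ.integrable_avg (abs_height_lt i).le hf
  calc ∫ x, |phi f x| ∂σ ≤ ∫ x, (|f x| + ∑ i, weight i * |avg (height i) f x|) ∂σ := by
        refine integral_mono (hσ.integrable_phi hf).abs
          (hf.abs.add (integrable_finsetSum _ fun i _ => (ha i).abs.const_mul _)) fun x => ?_
        refine (abs_add_le _ _).trans (add_le_add le_rfl ((abs_sum_le_sum_abs _ _).trans ?_))
        exact sum_le_sum fun i _ => by rw [abs_mul, abs_of_pos (weight_pos i)]
    _ = ∫ x, |f x| ∂σ + ∑ i, weight i * ∫ x, |avg (height i) f x| ∂σ := by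
        rw [integral_add hf.abs (integrable_finsetSum _ fun i _ => (ha i).abs.const_mul _),
          integral_finsetSum _ fun i _ => (ha i).abs.const_mul _]
        simp only [integral_const_mul]
    _ ≤ ∫ x, |f x| ∂σ + ∑ i, weight i * ∫ x, |f x| ∂σ := by
        exact add_le_add le_rfl (sum_le_sum fun i _ => mul_le_mul_of_nonneg_left
          (hσ.integral_abs_avg_le (abs_height_lt i).le hf) (weight_pos i).le)
    _ = 12 * ∫ x, |f x| ∂σ := by
        rw [← sum_mul, sum_weight]
        ring

/-- The matrix of the convolution operator on even moments. -/
def phiCoeff (m j : ℕ) : ℝ :=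
  (if j = m then 1 else 0) + ∑ i, weight i * (powAvg (height i) m).coeff j

lemma eigen_one (m : ℕ) : eigen 1 m = 1 := by
  rw [eigen, sum_eq_single 0]
  · simp
  · intro j _ hj
    simp [hj]
  · simp

lemma phiCoeff_self (m : ℕ) : phiCoeff m m = eigenPhi m := by
  simp only [phiCoeff, coeff_powAvg, eigenPhi, eigen_one, if_true]
  simp [Fin.sum_univ_succ, weight, height]
  ring

lemma IsSphereMeasure.moment_phi (hσ : IsSphereMeasure σ) {f : Euc3 → ℝ} (hf : Integrable f σ)
    {p : Euc3} (hp : ‖p‖ = 1) (m : ℕ) :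
    moment σ m (phi f) p = ∑ j ∈ range (m + 1), phiCoeff m j * moment σ j f p := by
  have ha i := hσ.integrable_mul_inner_pow (hσ.integrable_avg (abs_height_lt i).le hf) hp (2 * m)
  have h : moment σ m (phi f) p =
      moment σ m f p + ∑ i, weight i * moment σ m (avg (height i) f) p := by
    simp only [moment, phi, add_mul, sum_mul, mul_assoc]
    rw [integral_add (hσ.integrable_mul_inner_pow hf hp _)
      (integrable_finsetSum _ fun i _ => (ha i).const_mul _),
      integral_finsetSum _ fun i _ => (ha i).const_mul _]
    simp only [integral_const_mul]
  simp only [h, hσ.moment_avg (abs_height_lt _).le hf hp, phiCoeff, add_mul, sum_mul,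
    sum_add_distrib, mul_sum, ite_mul, one_mul, zero_mul, mul_assoc]
  rw [sum_comm]
  simp

/-- Even integrable functions whose second moments are those of a constant. -/
structure IsAdmissible (σ : Measure Euc3) (f : Euc3 → ℝ) : Prop where
  integrable : Integrable f σ
  even : ∀ x, ‖x‖ = 1 → f (-x) = f x
  moment_one : ∀ p, ‖p‖ = 1 → moment σ 1 f p = 1 / 3 * moment σ 0 f p

lemma IsSphereMeasure.exists_abs_moment_le (hσ : IsSphereMeasure σ) (m : ℕ) :
    ∃ C : ℝ, 0 ≤ C ∧ ∀ f, IsAdmissible σ f → ∀ p, ‖p‖ = 1 →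
      |moment σ m f p| ≤ C * ∫ x, |phi f x| ∂σ := by
  induction m using Nat.strong_induction_on with
  | _ m ih =>
  rcases eq_or_ne m 1 with rfl | hm
  · obtain ⟨C, hC, h⟩ := ih 0 one_pos
    refine ⟨1 / 3 * C, by positivity, fun f hf p hp => ?_⟩
    rw [hf.moment_one p hp, abs_mul, abs_of_pos (by norm_num : (0 : ℝ) < 1 / 3), mul_assoc]
    exact mul_le_mul_of_nonneg_left (h f hf p hp) (by norm_num)
  · have : ∀ j : ℕ, ∃ C : ℝ, 0 ≤ C ∧ (j < m → ∀ f, IsAdmissible σ f → ∀ p, ‖p‖ = 1 →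
        |moment σ j f p| ≤ C * ∫ x, |phi f x| ∂σ) := fun j => by
      by_cases hj : j < m
      · obtain ⟨C, hC, h⟩ := ih j hj
        exact ⟨C, hC, fun _ => h⟩
      · exact ⟨0, le_rfl, fun h => absurd h hj⟩
    choose C hC h using this
    have he := eigenPhi_ne_zero hm
    refine ⟨|eigenPhi m|⁻¹ * (1 + ∑ j ∈ range m, |phiCoeff m j| * C j),
      mul_nonneg (by positivity) (add_nonneg zero_le_one
        (sum_nonneg fun j _ => mul_nonneg (abs_nonneg _) (hC j))), fun f hf p hp => ?_⟩
    have h1 := hσ.moment_phi hf.integrable hp m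
    rw [sum_range_succ, phiCoeff_self] at h1
    have h2 := hσ.abs_moment_le (hσ.integrable_phi hf.integrable) hp m
    have h3 : |∑ j ∈ range m, phiCoeff m j * moment σ j f p| ≤
        (∑ j ∈ range m, |phiCoeff m j| * C j) * ∫ x, |phi f x| ∂σ := by
      rw [sum_mul]
      refine (abs_sum_le_sum_abs _ _).trans (sum_le_sum fun j hj => ?_)
      rw [abs_mul, mul_assoc]
      exact mul_le_mul_of_nonneg_left (h j (mem_range.1 hj) f hf p hp) (abs_nonneg _)
    rw [mul_assoc, inv_mul_eq_div, le_div_iff₀ (abs_pos.2 he), mul_comm, ← abs_mul,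
      ← sub_eq_iff_eq_add'.2 h1, add_mul, one_mul]
    exact (abs_sub _ _).trans (add_le_add h2 h3)

lemma IsSphereMeasure.integral_mul_inner_pow_odd (hσ : IsSphereMeasure σ) {f : Euc3 → ℝ}
    (hf : IsAdmissible σ f) {p : Euc3} (hp : ‖p‖ = 1) {k : ℕ} (hk : Odd k) :
    ∫ x, f x * ⟪x, p⟫ ^ k ∂σ = 0 := by
  have h := (hσ.inv (LinearIsometryEquiv.neg ℝ)).integral_comp_ae
    (hσ.integrable_mul_inner_pow hf.integrable hp k).aestronglyMeasurable
  have h' : ∫ x, f (LinearIsometryEquiv.neg ℝ x) * ⟪LinearIsometryEquiv.neg ℝ x, p⟫ ^ k ∂σ =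
      ∫ x, -(f x * ⟪x, p⟫ ^ k) ∂σ := by
    refine integral_congr_ae ?_
    filter_upwards [hσ.norm] with x hx
    rw [LinearIsometryEquiv.coe_neg, hf.even x hx, inner_neg_left, hk.neg_pow]
    ring
  rw [h', integral_neg] at h
  linarith

lemma IsSphereMeasure.exists_abs_integral_mul_eval_le (hσ : IsSphereMeasure σ) (q : ℝ[X]) :
    ∃ C : ℝ, ∀ f, IsAdmissible σ f → ∀ p, ‖p‖ = 1 →
      |∫ x, f x * q.eval ⟪x, p⟫ ∂σ| ≤ C * ∫ x, |phi f x| ∂σ := by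
  choose C hC h using hσ.exists_abs_moment_le
  refine ⟨∑ k ∈ range (q.natDegree + 1), |q.coeff k| * C (k / 2), fun f hf p hp => ?_⟩
  have hi k := hσ.integrable_mul_inner_pow hf.integrable hp k
  have h1 : ∫ x, f x * q.eval ⟪x, p⟫ ∂σ =
      ∑ k ∈ range (q.natDegree + 1), q.coeff k * ∫ x, f x * ⟪x, p⟫ ^ k ∂σ := by
    simp only [eval_eq_sum_range, mul_sum, mul_left_comm (f _)]
    rw [integral_finsetSum _ fun k _ => (hi k).const_mul _]
    simp only [integral_const_mul]
  rw [h1, sum_mul]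
  refine (abs_sum_le_sum_abs _ _).trans (sum_le_sum fun k _ => ?_)
  rw [abs_mul, mul_assoc]
  refine mul_le_mul_of_nonneg_left ?_ (abs_nonneg _)
  rcases k.even_or_odd' with ⟨m, rfl | rfl⟩
  · rw [Nat.mul_div_cancel_left _ two_pos]
    exact h m f hf p hp
  · rw [hσ.integral_mul_inner_pow_odd hf hp ⟨m, rfl⟩, abs_zero]
    exact mul_nonneg (hC _) (integral_nonneg fun _ => abs_nonneg _)

lemma integral_abs_le_of_eq_add_sum {f g : Euc3 → ℝ} {k : Fin 5 → Euc3 → ℝ}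
    (hg : Integrable g σ) (hk : ∀ i, Integrable (k i) σ)
    (h : ∀ᵐ x ∂σ, g x = f x + ∑ i, weight i * k i x) :
    ∫ x, |f x| ∂σ ≤ ∫ x, |g x| ∂σ + ∑ i, weight i * ∫ x, |k i x| ∂σ := by
  have hs : Integrable (fun x => ∑ i, weight i * |k i x|) σ :=
    integrable_finsetSum _ fun i _ => (hk i).abs.const_mul _
  calc ∫ x, |f x| ∂σ ≤ ∫ x, (|g x| + ∑ i, weight i * |k i x|) ∂σ := by
        refine integral_mono_of_nonneg (Filter.Eventually.of_forall fun _ => abs_nonneg _)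
          (hg.abs.add hs) ?_
        filter_upwards [h] with x hx
        rw [← sub_eq_iff_eq_add.2 hx]
        refine (abs_sub _ _).trans (add_le_add le_rfl ((abs_sum_le_sum_abs _ _).trans ?_))
        exact sum_le_sum fun i _ => by rw [abs_mul, abs_of_pos (weight_pos i)]
    _ = _ := by
        rw [integral_add hg.abs hs, integral_finsetSum _ fun i _ => (hk i).abs.const_mul _]
        simp only [integral_const_mul]

lemma IsSphereMeasure.avg_phi (hσ : IsSphereMeasure σ) {t : ℝ} (ht : |t| ≤ 1) {f : Euc3 → ℝ}
    (hf : Integrable f σ) :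
    ∀ᵐ x ∂σ, avg t (phi f) x = avg t f x + ∑ i, weight i * avg t (avg (height i) f) x := by
  have h : ∀ᵐ y ∂σ, ∀ i, Integrable
      (fun θ => avg (height i) f (swapIso pole y (circ t θ))) τ :=
    ae_all_iff.2 fun i => hσ.ae_integrable_avg ht (hσ.integrable_avg (abs_height_lt i).le hf)
  filter_upwards [hσ.ae_integrable_avg ht hf, h] with y h1 h2
  rw [avg]
  simp only [phi]
  rw [integral_add h1 (integrable_finsetSum _ fun i _ => (h2 i).const_mul _),
    integral_finsetSum _ fun i _ => (h2 i).const_mul _]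
  simp only [integral_const_mul]
  rfl

lemma IsSphereMeasure.exists_integral_abs_le (hσ : IsSphereMeasure σ) :
    ∃ C : ℝ, 0 < C ∧ ∀ f, IsAdmissible σ f → ∫ x, |f x| ∂σ ≤ C * ∫ x, |phi f x| ∂σ := by
  choose q hq using fun i j => hσ.exists_polynomial_approx (abs_height_lt i) (abs_height_lt j)
    (by norm_num : (0 : ℝ) < 1 / 242)
  choose C hC using fun i j => hσ.exists_abs_integral_mul_eval_le (q i j)
  refine ⟨24 + 2 * ∑ i, weight i * ∑ j, weight j * |C i j|, ?_, fun f hf => ?_⟩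
  · have : 0 ≤ ∑ i, weight i * ∑ j, weight j * |C i j| := sum_nonneg fun i _ =>
      mul_nonneg (weight_pos i).le (sum_nonneg fun j _ =>
        mul_nonneg (weight_pos j).le (abs_nonneg _))
    linarith
  set N := ∫ x, |f x| ∂σ
  set P := ∫ x, |phi f x| ∂σ
  have hi := hf.integrable
  have ha i := hσ.integrable_avg (abs_height_lt i).le hi
  have hP : 0 ≤ P := integral_nonneg fun _ => abs_nonneg _
  have h1 : N ≤ P + ∑ i, weight i * ∫ x, |avg (height i) f x| ∂σ :=
    integral_abs_le_of_eq_add_sum (hσ.integrable_phi hi) ha (Filter.Eventually.of_forall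
      fun _ => rfl)
  have h2 i : ∫ x, |avg (height i) f x| ∂σ ≤
      P + ∑ j, weight j * (1 / 242 * N + |C i j| * P) := by
    refine (integral_abs_le_of_eq_add_sum (hσ.integrable_avg (abs_height_lt i).le
      (hσ.integrable_phi hi)) (fun j => hσ.integrable_avg (abs_height_lt i).le (ha j))
      (hσ.avg_phi (abs_height_lt i).le hi)).trans ?_
    refine add_le_add (hσ.integral_abs_avg_le (abs_height_lt i).le (hσ.integrable_phi hi))
      (sum_le_sum fun j _ => mul_le_mul_of_nonneg_left ?_ (weight_pos j).le)
    refine (hq i j f hi _ (hC i j f hf)).trans (add_le_add le_rfl ?_)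
    exact mul_le_mul_of_nonneg_right (le_abs_self _) hP
  have h3 : N ≤ P + ∑ i, weight i * (P + ∑ j, weight j * (1 / 242 * N + |C i j| * P)) :=
    h1.trans (add_le_add le_rfl (sum_le_sum fun i _ =>
      mul_le_mul_of_nonneg_left (h2 i) (weight_pos i).le))
  simp only [mul_add, sum_add_distrib, ← sum_mul, sum_weight, ← mul_assoc] at h3 ⊢
  have h4 : ∑ i, weight i * ∑ j, weight j * |C i j| * P =
      (∑ i, weight i * ∑ j, weight j * |C i j|) * P := by
    simp only [sum_mul, mul_assoc]
  linarith

lemma avg_even {f : Euc3 → ℝ} (hf : ∀ x, ‖x‖ = 1 → f (-x) = f x) {t : ℝ} (ht : |t| ≤ 1)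
    {y : Euc3} (hy : ‖y‖ = 1) : avg t f (-y) = avg t f y := by
  have h : swapIso pole y pole = y := swapIso_left (by rw [norm_pole, hy])
  have h1 := avg_eq (swapIso pole y) t f
  have h2 := avg_eq ((swapIso pole y).trans (LinearIsometryEquiv.neg ℝ)) t f
  simp only [LinearIsometryEquiv.trans_apply, LinearIsometryEquiv.coe_neg, h] at h1 h2
  rw [h1, h2]
  congr 1
  funext θ
  exact hf _ (by rw [LinearIsometryEquiv.norm_map, norm_circ ht])

lemma phi_even {f : Euc3 → ℝ} (hf : ∀ x, ‖x‖ = 1 → f (-x) = f x) {y : Euc3} (hy : ‖y‖ = 1) :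
    phi f (-y) = phi f y := by
  simp only [phi, hf y hy, avg_even hf (abs_height_lt _).le hy]

lemma coeff_powAvg_zero_zero (t : ℝ) : (powAvg t 0).coeff 0 = 1 := by
  simp [powAvg]

lemma coeff_powAvg_one_zero (t : ℝ) : (powAvg t 1).coeff 0 = (1 - t ^ 2) / 2 := by
  simp [powAvg, sum_range_succ, Nat.centralBinom, coeff_zero_eq_eval_zero]
  ring

lemma coeff_powAvg_one_one (t : ℝ) : (powAvg t 1).coeff 1 = t ^ 2 - (1 - t ^ 2) / 2 := by
  simp [coeff_powAvg, eigen, sum_range_succ, Nat.centralBinom]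
  ring

lemma IsSphereMeasure.isAdmissible_phi (hσ : IsSphereMeasure σ) {f : Euc3 → ℝ}
    (hf : IsAdmissible σ f) : IsAdmissible σ (phi f) where
  integrable := hσ.integrable_phi hf.integrable
  even x hx := phi_even hf.even hx
  moment_one p hp := by
    rw [hσ.moment_phi hf.integrable hp, hσ.moment_phi hf.integrable hp]
    simp [sum_range_succ, phiCoeff, hf.moment_one p hp, coeff_powAvg_zero_zero,
      coeff_powAvg_one_zero, coeff_powAvg_one_one, Fin.sum_univ_succ, weight, height]
    ring

end SphereAvg

namespace SphereAvg

open Finset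

variable {σ : Measure Euc3}

lemma det_reflection_orthogonal {v : Euc3} (hv : v ≠ 0) :
    LinearMap.det ((ℝ ∙ v)ᗮ.reflection.toLinearEquiv.toLinearMap) = -1 := by
  have h := (ℝ ∙ v)ᗮ.det_reflection
  rw [Submodule.orthogonal_orthogonal, finrank_span_singleton hv, pow_one] at h
  exact h

lemma exists_rotation {y : Euc3} (hy : ‖y‖ = 1) : ∃ U : Euc3 ≃ₗᵢ[ℝ] Euc3,
    LinearMap.det U.toLinearEquiv.toLinearMap = 1 ∧ U pole = y := by
  rcases eq_or_ne pole y with rfl | h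
  · exact ⟨LinearIsometryEquiv.refl ℝ Euc3, LinearMap.det_id, rfl⟩
  · have he : (!₂[0, 1, 0] : Euc3) ≠ 0 := fun h0 => by
      simpa using congrArg (fun v : Euc3 => v 1) h0
    refine ⟨(ℝ ∙ (!₂[0, 1, 0] : Euc3))ᗮ.reflection.trans (swapIso pole y), ?_, ?_⟩
    · have h1 := det_reflection_orthogonal he
      have h2 := det_reflection_orthogonal (sub_ne_zero.2 h)
      have h3 := LinearMap.det_comp (swapIso pole y).toLinearEquiv.toLinearMap
        (ℝ ∙ (!₂[0, 1, 0] : Euc3))ᗮ.reflection.toLinearEquiv.toLinearMap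
      rw [h1, show LinearMap.det (swapIso pole y).toLinearEquiv.toLinearMap = -1 from h2] at h3
      refine Eq.trans ?_ (h3.trans (by norm_num))
      rfl
    · have hp : (ℝ ∙ (!₂[0, 1, 0] : Euc3))ᗮ.reflection pole = pole := by
        rw [Submodule.reflection_eq_self_iff, Submodule.mem_orthogonal_singleton_iff_inner_right,
          inner_pole]
        rfl
      rw [LinearIsometryEquiv.trans_apply, hp, swapIso_left (by rw [norm_pole, hy])]

lemma avg_one (f : Euc3 → ℝ) {y : Euc3} (hy : ‖y‖ = 1) : avg 1 f y = f y := by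
  have h (θ : Circ) : circ 1 θ = pole := by refine ext3 ?_ ?_ ?_ <;> simp
  simp [avg, h, swapIso_left (show ‖pole‖ = ‖y‖ by rw [norm_pole, hy])]

lemma sphereσ_eq_zero_or : sphereσ = 0 ∨ IsSphereMeasure sphereσ := by
  rcases eq_or_ne (Measure.hausdorffMeasure 2 (Metric.sphere (0 : Euc3) 1)) 0 with h0 | h0
  · left
    rw [sphereσ, Measure.restrict_eq_zero.2 h0, smul_zero]
  rcases eq_or_ne (Measure.hausdorffMeasure 2 (Metric.sphere (0 : Euc3) 1)) ⊤ with h1 | h1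
  · left
    rw [sphereσ, h1, ENNReal.inv_top, zero_smul]
  right
  refine ⟨⟨?_⟩, ?_, fun U => ?_⟩
  · rw [sphereσ, Measure.smul_apply, Measure.restrict_apply_univ, smul_eq_mul,
      ENNReal.inv_mul_cancel h0 h1]
  · refine Measure.ae_smul_measure ?_ _
    filter_upwards [ae_restrict_mem Metric.isClosed_sphere.measurableSet] with x hx
    simpa using hx
  · have h := (U.toIsometryEquiv.measurePreserving_hausdorffMeasure 2).restrict_preimage
      (Metric.isClosed_sphere (x := (0 : Euc3)) (ε := 1)).measurableSet
    have hs : U.toIsometryEquiv ⁻¹' Metric.sphere (0 : Euc3) 1 = Metric.sphere (0 : Euc3) 1 := by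
      ext x
      simp
    rw [hs] at h
    exact h.smul_measure _

lemma inner_toEuclideanLin (A : Matrix (Fin 3) (Fin 3) ℝ) (x : Euc3) :
    ⟪x, Matrix.toEuclideanLin A x⟫ = ∑ i, ∑ j, A i j * (x i * x j) := by
  simp [inner_eq, Matrix.toLpLin_apply, Matrix.mulVec, dotProduct, Fin.sum_univ_three]
  ring

lemma isAdmissible_of_memZ (hσ : IsSphereMeasure sphereσ) {f : Euc3 → ℝ} (hf : memZ f) :
    IsAdmissible sphereσ f where
  integrable := hf.1
  even := hf.2.1
  moment_one p hp := by
    have h1 := hσ.integrable_mul_inner_pow hf.1 hp (2 * 1)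
    have h0 := hσ.integrable_mul_inner_pow hf.1 hp (2 * 0)
    rw [moment, moment, ← sub_eq_zero, ← integral_const_mul,
      ← integral_sub h1 (h0.const_mul _),
      ← hf.2.2 (Matrix.of fun i j => p i * p j - if i = j then 1 / 3 else 0) ?_ ?_]
    · refine integral_congr_ae ?_
      filter_upwards [hσ.norm] with x hx
      rw [norm_eq_one_iff] at hx
      rw [inner_toEuclideanLin, inner_eq]
      simp [Fin.sum_univ_three]
      linear_combination (1 / 3 * f x) * hx
    · ext i j
      simp [mul_comm, eq_comm]
    · rw [norm_eq_one_iff] at hp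
      simp [Matrix.trace, Fin.sum_univ_three]
      linear_combination hp

lemma IsSphereMeasure.integrable_mul_coord (hσ : IsSphereMeasure σ) {f : Euc3 → ℝ}
    (hf : Integrable f σ) (i j : Fin 3) : Integrable (fun x => f x * (x i * x j)) σ := by
  refine hf.mul_bdd (c := 1) (by fun_prop) ?_
  filter_upwards [hσ.norm] with x hx
  rw [norm_mul]
  have h k : ‖x k‖ ≤ 1 := hx ▸ PiLp.norm_apply_le x k
  exact mul_le_one₀ (h i) (norm_nonneg _) (h j)

lemma IsSphereMeasure.moment_one_eq (hσ : IsSphereMeasure σ) {f : Euc3 → ℝ}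
    (hf : Integrable f σ) (p : Euc3) :
    moment σ 1 f p = ∑ i, ∑ j, p i * p j * ∫ x, f x * (x i * x j) ∂σ := by
  have hi i j := (hσ.integrable_mul_coord hf i j).const_mul (p i * p j)
  simp only [← integral_const_mul]
  rw [moment, ← Finset.sum_congr rfl fun i _ => integral_finsetSum _ fun j _ => hi i j,
    ← integral_finsetSum _ fun i _ => integrable_finsetSum _ fun j _ => hi i j]
  congr 1
  funext x
  simp [inner_eq, Fin.sum_univ_three]
  ring

lemma memZ_of_isAdmissible (hσ : IsSphereMeasure sphereσ) {f : Euc3 → ℝ}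
    (hf : IsAdmissible sphereσ f) : memZ f := by
  refine ⟨hf.integrable, hf.even, fun A _ hA => ?_⟩
  have hi i j := (hσ.integrable_mul_coord hf.integrable i j).const_mul (A i j)
  set I : Fin 3 → Fin 3 → ℝ := fun i j => ∫ x, f x * (x i * x j) ∂sphereσ with hI
  have h : ∫ x, f x * ⟪x, Matrix.toEuclideanLin A x⟫ ∂sphereσ = ∑ i, ∑ j, A i j * I i j := by
    simp only [hI, ← integral_const_mul]
    rw [← Finset.sum_congr rfl fun i _ => integral_finsetSum _ fun j _ => hi i j,
      ← integral_finsetSum _ fun i _ => integrable_finsetSum _ fun j _ => hi i j]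
    congr 1
    funext x
    simp only [inner_toEuclideanLin, mul_sum, mul_left_comm (f x)]
  have hs i j : I i j = I j i := by
    simp only [hI]
    congr 1
    funext x
    ring
  set c := 1 / 3 * ∫ x, f x ∂sphereσ
  have hm (p : Euc3) (hp : ‖p‖ = 1) : ∑ i, ∑ j, p i * p j * I i j = c := by
    rw [← hσ.moment_one_eq hf.integrable, hf.moment_one p hp]
    simp [moment, c]
  have h0 := hm !₂[1, 0, 0] (by simp [norm_eq_one_iff])
  have h1 := hm !₂[0, 1, 0] (by simp [norm_eq_one_iff])
  have h2 := hm !₂[0, 0, 1] (by simp [norm_eq_one_iff])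
  have h01 := hm !₂[3 / 5, 4 / 5, 0] (by simp [norm_eq_one_iff]; norm_num)
  have h02 := hm !₂[3 / 5, 0, 4 / 5] (by simp [norm_eq_one_iff]; norm_num)
  have h12 := hm !₂[0, 3 / 5, 4 / 5] (by simp [norm_eq_one_iff]; norm_num)
  simp [Fin.sum_univ_three] at h0 h1 h2 h01 h02 h12
  have e01 : I 0 1 = 0 := by linarith [hs 1 0]
  have e02 : I 0 2 = 0 := by linarith [hs 2 0]
  have e12 : I 1 2 = 0 := by linarith [hs 2 1]
  rw [Matrix.trace, Fin.sum_univ_three] at hA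
  simp only [Matrix.diag_apply] at hA
  simp only [h, Fin.sum_univ_three, hs 1 0, hs 2 0, hs 2 1, e01, e02, e12, h0, h1, h2]
  linear_combination c * hA

lemma IsSphereMeasure.isAdmissible_congr (hσ : IsSphereMeasure σ) {f g : Euc3 → ℝ}
    (hf : IsAdmissible σ f) (h : ∀ x, ‖x‖ = 1 → g x = f x) : IsAdmissible σ g := by
  have hae : g =ᵐ[σ] f := hσ.norm.mono h
  have hm m p : moment σ m g p = moment σ m f p := by
    refine integral_congr_ae ?_
    filter_upwards [hae] with x hx
    rw [hx]
  exact ⟨hf.integrable.congr hae.symm, fun x hx => by rw [h _ hx, h _ (by rwa [norm_neg]),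
    hf.even x hx], fun p hp => by rw [hm, hm, hf.moment_one p hp]⟩

lemma IsSphereMeasure.isAdmissible_sub (hσ : IsSphereMeasure σ) {f g : Euc3 → ℝ}
    (hf : IsAdmissible σ f) (hg : IsAdmissible σ g) : IsAdmissible σ (f - g) where
  integrable := hf.integrable.sub hg.integrable
  even x hx := by simp only [Pi.sub_apply, hf.even x hx, hg.even x hx]
  moment_one p hp := by
    have hm m : moment σ m (f - g) p = moment σ m f p - moment σ m g p := by
      simp only [moment, Pi.sub_apply, sub_mul]
      exact integral_sub (hσ.integrable_mul_inner_pow hf.integrable hp _)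
        (hσ.integrable_mul_inner_pow hg.integrable hp _)
    rw [hm, hm, hf.moment_one p hp, hg.moment_one p hp]
    ring

lemma IsSphereMeasure.phi_sub (hσ : IsSphereMeasure σ) {f g : Euc3 → ℝ}
    (hf : Integrable f σ) (hg : Integrable g σ) : phi (f - g) =ᵐ[σ] phi f - phi g := by
  have h : ∀ᵐ y ∂σ, ∀ i, avg (height i) (f - g) y = avg (height i) f y - avg (height i) g y := by
    refine ae_all_iff.2 fun i => ?_
    filter_upwards [hσ.ae_integrable_avg (abs_height_lt i).le hf,
      hσ.ae_integrable_avg (abs_height_lt i).le hg] with y h1 h2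
    exact integral_sub h1 h2
  filter_upwards [h] with y hy
  simp only [phi, hy, Pi.sub_apply, mul_sub, sum_sub_distrib]
  ring

lemma IsSphereMeasure.ae_eq_of_phi_ae_eq (hσ : IsSphereMeasure σ) {f g : Euc3 → ℝ}
    (hf : IsAdmissible σ f) (hg : IsAdmissible σ g) (h : phi f =ᵐ[σ] phi g) : f =ᵐ[σ] g := by
  obtain ⟨C, -, hC⟩ := hσ.exists_integral_abs_le
  have hfg := hσ.isAdmissible_sub hf hg
  have h0 : ∫ x, |phi (f - g) x| ∂σ = 0 := by
    refine integral_eq_zero_of_ae ?_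
    filter_upwards [hσ.phi_sub hf.integrable hg.integrable, h] with x h1 h2
    simp [h1, h2]
  have h1 := hC _ hfg
  rw [h0, mul_zero] at h1
  have h2 := (integral_eq_zero_iff_of_nonneg (fun _ => abs_nonneg _) hfg.integrable.abs).1
    (h1.antisymm (integral_nonneg fun _ => abs_nonneg _))
  filter_upwards [h2] with x hx
  exact sub_eq_zero.1 (abs_eq_zero.1 hx)

end SphereAvg

/-- Let `A t` be the operator averaging a function on `S²` over circles at height `t`:
for any rotation `U` with `U p = y`, `A t f y` is the average of `f` over the circle
`{z : ⟨z, y⟩ = t}` with respect to normalized arclength (for `t = 1` this gives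
`A 1 f y = f y`). Then `Φ = A₁ + 3A_{4/5} + A_{3/5} + 4A_{2/5} + 2A_{1/5} + A₀` maps `Z` to
`Z`, is bounded in the `L¹(σ)` norm, is one-to-one on `Z`, and has a bounded inverse:
`‖Φ f‖₁ ≥ c ‖f‖₁` for some `c > 0`. -/
theorem convolution_operator_bounded_below (A : ℝ → (Euc3 → ℝ) → Euc3 → ℝ)
    (hA : ∀ t ∈ ({1, 4/5, 3/5, 2/5, 1/5, 0} : Set ℝ), ∀ f : Euc3 → ℝ, ∀ y : Euc3, ‖y‖ = 1 →
      ∀ U : Euc3 ≃ₗᵢ[ℝ] Euc3, LinearMap.det U.toLinearEquiv.toLinearMap = 1 → U pole = y →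
        A t f y = (2 * Real.pi)⁻¹ * ∫ θ in (0 : ℝ)..(2 * Real.pi), f (U (circlePt t θ))) :
    (∀ f, memZ f → memZ (PhiOp A f)) ∧
    (∃ C : ℝ, 0 < C ∧ ∀ f, memZ f →
      (∫ x, |PhiOp A f x| ∂sphereσ) ≤ C * ∫ x, |f x| ∂sphereσ) ∧
    (∀ f g, memZ f → memZ g → PhiOp A f =ᵐ[sphereσ] PhiOp A g → f =ᵐ[sphereσ] g) ∧
    (∃ c : ℝ, 0 < c ∧ ∀ f, memZ f →
      c * (∫ x, |f x| ∂sphereσ) ≤ ∫ x, |PhiOp A f x| ∂sphereσ) := by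
  have havg : ∀ t ∈ ({1, 4/5, 3/5, 2/5, 1/5, 0} : Set ℝ), ∀ f y, ‖y‖ = 1 →
      A t f y = SphereAvg.avg t f y := by
    intro t ht f y hy
    obtain ⟨U, hU, hUy⟩ := SphereAvg.exists_rotation hy
    rw [hA t ht f y hy U hU hUy, ← hUy, SphereAvg.avg_eq, SphereAvg.integral_τ]
    simp only [SphereAvg.circ_coe]
  have hphi : ∀ f y, ‖y‖ = 1 → PhiOp A f y = SphereAvg.phi f y := by
    intro f y hy
    simp only [PhiOp, SphereAvg.phi]
    rw [havg 1 (by simp) f y hy, havg (4 / 5) (by simp) f y hy, havg (3 / 5) (by simp) f y hy,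
      havg (2 / 5) (by simp) f y hy, havg (1 / 5) (by simp) f y hy, havg 0 (by simp) f y hy,
      SphereAvg.avg_one f hy]
    simp [Fin.sum_univ_succ, SphereAvg.weight, SphereAvg.height]
    ring
  rcases SphereAvg.sphereσ_eq_zero_or with h0 | hσ
  · refine ⟨fun f hf => ⟨?_, fun x hx => ?_, ?_⟩, ⟨1, one_pos, ?_⟩, ?_, ⟨1, one_pos, ?_⟩⟩
    · rw [h0]
      exact integrable_zero_measure
    · rw [hphi f x hx, hphi f (-x) (by rwa [norm_neg]), SphereAvg.phi_even hf.2.1 hx]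
    all_goals simp [h0, Filter.EventuallyEq]
  have hae : ∀ f, PhiOp A f =ᵐ[sphereσ] SphereAvg.phi f := fun f => hσ.norm.mono (hphi f)
  have h_int : ∀ f, ∫ x, |PhiOp A f x| ∂sphereσ = ∫ x, |SphereAvg.phi f x| ∂sphereσ :=
    fun f => integral_congr_ae ((hae f).fun_comp abs)
  have hZ : ∀ {f}, memZ f → SphereAvg.IsAdmissible sphereσ f :=
    fun hf => SphereAvg.isAdmissible_of_memZ hσ hf
  refine ⟨fun f hf => ?_, ⟨12, by norm_num, fun f hf => ?_⟩, fun f g hf hg h => ?_, ?_⟩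
  · exact SphereAvg.memZ_of_isAdmissible hσ
      (hσ.isAdmissible_congr (hσ.isAdmissible_phi (hZ hf)) (hphi f))
  · rw [h_int]
    exact hσ.integral_abs_phi_le hf.1
  · exact hσ.ae_eq_of_phi_ae_eq (hZ hf) (hZ hg) ((hae f).symm.trans (h.trans (hae g)))
  · obtain ⟨C, hC, h⟩ := hσ.exists_integral_abs_le
    refine ⟨C⁻¹, inv_pos.2 hC, fun f hf => ?_⟩
    rw [h_int, inv_mul_le_iff₀ hC]
    exact h f (hZ hf)
end
end
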